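/- arXiv:2006.00507 — 4 statements merged into one kernel-verified Lean document; each statement's English description precedes it below -/
import Mathlib

section
/- For all integers n ≥ 1, the number of Simsun permutations of [n-1] equals the number of down-up alternating permutations of [n]; that is, #RS_{n-1} = #DU_n. -/
/-- `w` is a down-up alternating word: `w 0 > w 1 < w 2 > w 3 < ⋯` (0-indexed). -/
def DownUpWord {α : Type*} [LT α] (w : List α) : Prop :=
  ∀ i : ℕ, ∀ h : i + 1 < w.length,
    (i % 2 = 0 → w.get ⟨i + 1, h⟩ < w.get ⟨i, Nat.lt_of_succ_lt h⟩) ∧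
    (i % 2 = 1 → w.get ⟨i, Nat.lt_of_succ_lt h⟩ < w.get ⟨i + 1, h⟩)

/-- A word has a double descent if `w i > w (i+1) > w (i+2)` for some `i`. -/
def HasDoubleDescent {α : Type*} [LT α] (w : List α) : Prop :=
  ∃ i : ℕ, ∃ h : i + 2 < w.length,
    w.get ⟨i + 1, by omega⟩ < w.get ⟨i, by omega⟩ ∧
    w.get ⟨i + 2, h⟩ < w.get ⟨i + 1, by omega⟩

/-- Simsun permutation of `[n]`: every subword `σ_[k]` has no double descents. -/
def IsSimsun (n : ℕ) (l : List ℕ) : Prop :=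
  l.Perm (List.range' 1 n) ∧
  ∀ k : ℕ, 1 ≤ k → k ≤ n →
    ¬ HasDoubleDescent (l.filter (fun x => decide (x ≤ k)))

section Simsun

open List

theorem not_hasDoubleDescent_of_length_le_two {l : List ℕ} (hl : l.length ≤ 2) :
    ¬ HasDoubleDescent l := by
  rintro ⟨i, hi, -⟩
  omega

theorem hasDoubleDescent_cons_cons_cons {a b c : ℕ} {l : List ℕ} :
    HasDoubleDescent (a :: b :: c :: l) ↔ (b < a ∧ c < b) ∨ HasDoubleDescent (b :: c :: l) := by
  constructor
  · rintro ⟨_ | i, hi, h⟩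
    · exact Or.inl h
    · exact Or.inr ⟨i, by simpa using hi, h⟩
  · rintro (h | ⟨i, hi, h⟩)
    · exact ⟨0, by simp, h⟩
    · exact ⟨i + 1, by simpa using hi, h⟩

/-- Prefixing an entry that does not start a descent does not create a double descent. -/
theorem hasDoubleDescent_cons_iff {a : ℕ} {l : List ℕ} (h : ∀ b ∈ l.head?, a < b) :
    HasDoubleDescent (a :: l) ↔ HasDoubleDescent l := by
  match l with
  | [] => simp [not_hasDoubleDescent_of_length_le_two]
  | [b] => simp [not_hasDoubleDescent_of_length_le_two]
  | b :: c :: l =>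
    have : a < b := h b (by simp)
    rw [hasDoubleDescent_cons_cons_cons]
    grind

/-- The monomial attached to a word without double descents: every entry that starts a descent
contributes `x` together with its successor, every other entry contributes `y`, and there is one
extra factor `x`. -/
noncomputable def descentWeight {R : Type*} [CommRing R] (x y : R) : List ℕ → R
  | [] => x
  | [_] => y * x
  | b :: c :: l =>
    if c < b then x * descentWeight x y l else y * descentWeight x y (c :: l)

theorem descentWeight_cons {R : Type*} [CommRing R] (x y : R) {a : ℕ} {l : List ℕ}
    (h : ∀ b ∈ l.head?, a < b) : descentWeight x y (a :: l) = y * descentWeight x y l := by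
  match l with
  | [] => simp [descentWeight]
  | b :: l =>
    have : a < b := h b (by simp)
    rw [descentWeight, if_neg (by omega)]

theorem descentWeight_one_one {R : Type*} [CommRing R] (l : List ℕ) :
    descentWeight (1 : R) 1 l = 1 := by
  induction l using descentWeight.induct <;> simp_all [descentWeight]

theorem map_descentWeight {R S : Type*} [CommRing R] [CommRing S] (f : R →+* S) (x y : R)
    (l : List ℕ) : f (descentWeight x y l) = descentWeight (f x) (f y) l := by
  induction l using descentWeight.induct <;>
    simp only [descentWeight, map_mul, if_true, if_false, *]

theorem mem_permutations'Aux_iff {α : Type*} {a : α} {l l' : List α} :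
    l' ∈ permutations'Aux a l ↔ ∃ u v, l = u ++ v ∧ l' = u ++ a :: v := by
  induction l generalizing l' with
  | nil => simp [permutations'Aux]
  | cons b l ih =>
    simp only [permutations'Aux, mem_cons, mem_map, ih]
    constructor
    · rintro (rfl | ⟨_, ⟨u, v, rfl, rfl⟩, rfl⟩)
      · exact ⟨[], _, rfl, rfl⟩
      · exact ⟨b :: u, v, rfl, rfl⟩
    · rintro ⟨_ | ⟨c, u⟩, v, h, rfl⟩
      · simp_all
      · simp only [cons_append, cons.injEq] at h
        exact Or.inr ⟨_, ⟨u, v, h.2, rfl⟩, by simp [h.1]⟩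

theorem lt_head_of_mem_permutations'Aux {a c : ℕ} {l l' : List ℕ} (hca : c < a)
    (h : ∀ b ∈ l.head?, c < b) (hl' : l' ∈ permutations'Aux a l) : ∀ b ∈ l'.head?, c < b := by
  obtain ⟨_ | ⟨d, u⟩, v, rfl, rfl⟩ := mem_permutations'Aux_iff.1 hl'
  · simpa using hca
  · simpa using h

open Classical in
theorem sum_filter_permutations'Aux_cons {R : Type*} [CommRing R] (x y : R) {a c : ℕ} {l : List ℕ}
    (hca : c < a) (h : ∀ b ∈ l.head?, c < b) :
    ((((permutations'Aux a l).map (cons c)).filter (¬ HasDoubleDescent ·)).map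
      (descentWeight x y)).sum =
    y * (((permutations'Aux a l).filter (¬ HasDoubleDescent ·)).map (descentWeight x y)).sum := by
  rw [filter_map, map_map, ← sum_map_mul_left]
  have hf : (permutations'Aux a l).filter ((fun w => decide (¬ HasDoubleDescent w)) ∘ cons c) =
      (permutations'Aux a l).filter (¬ HasDoubleDescent ·) :=
    filter_congr fun w hw => by
      simp [hasDoubleDescent_cons_iff (lt_head_of_mem_permutations'Aux hca h hw)]
  rw [hf]
  refine congrArg _ (map_congr_left fun w hw => ?_)
  exact descentWeight_cons x y (lt_head_of_mem_permutations'Aux hca h (mem_of_mem_filter hw))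

open Classical in
theorem sum_filter_permutations'Aux_cons_cons {R : Type*} [CommRing R] (x y : R) {a b c : ℕ}
    {l : List ℕ} (hcb : c < b) (hca : c < a) (h : ∀ d ∈ l.head?, c < d) :
    ((((permutations'Aux a l).map (cons b ∘ cons c)).filter (¬ HasDoubleDescent ·)).map
      (descentWeight x y)).sum =
    x * (((permutations'Aux a l).filter (¬ HasDoubleDescent ·)).map (descentWeight x y)).sum := by
  rw [filter_map, map_map, ← sum_map_mul_left]
  have hf : (permutations'Aux a l).filter
      ((fun w => decide (¬ HasDoubleDescent w)) ∘ (cons b ∘ cons c)) =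
      (permutations'Aux a l).filter (¬ HasDoubleDescent ·) :=
    filter_congr fun w hw => by
      have hw' := lt_head_of_mem_permutations'Aux hca h hw
      have : HasDoubleDescent (b :: c :: w) ↔ HasDoubleDescent w := by
        match w with
        | [] => simp [not_hasDoubleDescent_of_length_le_two]
        | d :: w =>
          have : c < d := hw' d (by simp)
          rw [hasDoubleDescent_cons_cons_cons, hasDoubleDescent_cons_iff hw']
          grind
      simp [this]
  rw [hf]
  refine congrArg _ (map_congr_left fun w hw => ?_)
  simp [descentWeight, hcb]

open Classical in
/-- Inserting a new largest entry in all admissible ways differentiates the weight, for the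
derivation with `x ↦ x * y` and `y ↦ x`. -/
theorem sum_descentWeight_permutations'Aux {A R : Type*} [CommSemiring A] [CommRing R] [Algebra A R]
    (D : Derivation A R R)
    {x y : R} (hx : D x = x * y) (hy : D y = x) (a : ℕ) (l : List ℕ) (hl : l.Nodup)
    (hlt : ∀ b ∈ l, b < a) (hdd : ¬ HasDoubleDescent l) :
    (((permutations'Aux a l).filter (¬ HasDoubleDescent ·)).map (descentWeight x y)).sum =
      D (descentWeight x y l) := by
  induction l using descentWeight.induct with
  | case1 =>
    simp [permutations'Aux, not_hasDoubleDescent_of_length_le_two, descentWeight, hx, mul_comm]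
  | case2 b =>
    have hba : b < a := hlt b (by simp)
    simp [permutations'Aux, not_hasDoubleDescent_of_length_le_two, descentWeight, hx, hy, hba,
      hba.not_gt]
    ring
  | case3 b c l hcb ih =>
    have hca : c < a := hlt c (by simp)
    have hba : b < a := hlt b (by simp)
    have hhead : ∀ d ∈ l.head?, c < d := by
      match l with
      | [] => simp
      | d :: l =>
        rw [hasDoubleDescent_cons_cons_cons] at hdd
        simp at hl
        simp
        grind
    have hl0 : ¬ HasDoubleDescent l := by
      rw [← hasDoubleDescent_cons_iff hhead]
      match l with
      | [] => simp [not_hasDoubleDescent_of_length_le_two]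
      | d :: l =>
        rw [hasDoubleDescent_cons_cons_cons] at hdd
        tauto
    have h1 : HasDoubleDescent (a :: b :: c :: l) :=
      hasDoubleDescent_cons_cons_cons.2 (Or.inl ⟨hba, hcb⟩)
    have h2 : ¬ HasDoubleDescent (b :: a :: c :: l) := by
      rw [hasDoubleDescent_cons_iff (by simpa using hba)]
      match l with
      | [] => simp [not_hasDoubleDescent_of_length_le_two]
      | d :: l =>
        have : c < d := hhead d (by simp)
        rw [hasDoubleDescent_cons_cons_cons, hasDoubleDescent_cons_iff hhead]
        grind
    specialize ih (by simp at hl; tauto) (fun d hd => hlt d (by simp [hd])) hl0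
    rw [permutations'Aux, permutations'Aux, map_cons, map_map, filter_cons_of_neg (by simp [h1]),
      filter_cons_of_pos (by simp [h2]), map_cons, sum_cons,
      sum_filter_permutations'Aux_cons_cons x y hcb hca hhead, ih, descentWeight,
      if_neg (by omega), descentWeight, if_pos hca, descentWeight, if_pos hcb]
    simp [hx]
    ring
  | case4 b c l hcb ih =>
    have hba : b < a := hlt b (by simp)
    have hca : c < a := hlt c (by simp)
    have hbc : b < c := by simp at hl; grind
    have hhead : ∀ d ∈ (c :: l).head?, b < d := by simpa using hbc
    rw [hasDoubleDescent_cons_iff hhead] at hdd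
    have h1 : ¬ HasDoubleDescent (a :: b :: c :: l) := by
      rw [hasDoubleDescent_cons_cons_cons, hasDoubleDescent_cons_iff hhead]
      grind
    specialize ih (by simp at hl ⊢; tauto) (fun d hd => hlt d (mem_cons_of_mem _ hd)) hdd
    rw [permutations'Aux, filter_cons_of_pos (by simp [h1]), map_cons, sum_cons,
      sum_filter_permutations'Aux_cons x y hba hhead, ih, descentWeight, if_pos hba,
      descentWeight_cons x y hhead]
    simp [hy]
    ring

open Classical in
/-- The list of all Simsun permutations of `[m]`, built by inserting the entries in order. -/
noncomputable def simsunList : ℕ → List (List ℕ)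
  | 0 => [[]]
  | m + 1 => (simsunList m).flatMap fun l =>
      (permutations'Aux (m + 1) l).filter (¬ HasDoubleDescent ·)

theorem IsSimsun.lt {m : ℕ} {l : List ℕ} (h : IsSimsun m l) : ∀ b ∈ l, b < m + 1 := by
  intro b hb
  have := h.1.mem_iff.1 hb
  simp at this
  omega

theorem IsSimsun.not_hasDoubleDescent {m : ℕ} {l : List ℕ} (h : IsSimsun m l) :
    ¬ HasDoubleDescent l := by
  rcases m.eq_zero_or_pos with rfl | hm
  · have := h.1.length_eq
    exact not_hasDoubleDescent_of_length_le_two (by simp at this; simp [this])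
  · have := h.2 m hm le_rfl
    rwa [filter_eq_self.2] at this
    intro b hb
    have := h.lt b hb
    simp
    omega

theorem isSimsun_succ_iff {m : ℕ} {l' : List ℕ} :
    IsSimsun (m + 1) l' ↔
      ∃ l, IsSimsun m l ∧ l' ∈ permutations'Aux (m + 1) l ∧ ¬ HasDoubleDescent l' := by
  have hrange : range' 1 (m + 1) ~ (m + 1) :: range' 1 m := by
    rw [range'_concat]
    simp [add_comm]
  have hfilter : ∀ (u v : List ℕ) (k : ℕ), k ≤ m →
      (u ++ (m + 1) :: v).filter (fun x => decide (x ≤ k)) =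
        (u ++ v).filter (fun x => decide (x ≤ k)) := by
    intro u v k hk
    rw [filter_append, filter_cons_of_neg (by simp; omega), filter_append]
  constructor
  · intro h
    obtain ⟨u, v, rfl⟩ := append_of_mem (h.1.mem_iff.2 (by simp) : m + 1 ∈ l')
    refine ⟨u ++ v, ⟨?_, fun k hk hkm => ?_⟩, mem_permutations'Aux_iff.2 ⟨u, v, rfl, rfl⟩,
      h.not_hasDoubleDescent⟩
    · exact (perm_middle.symm.trans (h.1.trans hrange)).cons_inv
    · rw [← hfilter u v k hkm]
      exact h.2 k hk (by omega)
  · rintro ⟨l, h, hl', hdd⟩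
    obtain ⟨u, v, rfl, rfl⟩ := mem_permutations'Aux_iff.1 hl'
    have hperm : u ++ (m + 1) :: v ~ range' 1 (m + 1) :=
      perm_middle.trans ((h.1.cons _).trans hrange.symm)
    refine ⟨hperm, fun k hk hkm => ?_⟩
    rcases hkm.lt_or_eq with hlt | rfl
    · rw [hfilter u v k (by omega)]
      exact h.2 k hk (by omega)
    · rwa [filter_eq_self.2]
      intro b hb
      have := hperm.mem_iff.1 hb
      simp at this
      simp
      omega

theorem mem_simsunList {m : ℕ} {l : List ℕ} : l ∈ simsunList m ↔ IsSimsun m l := by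
  induction m generalizing l with
  | zero =>
    simp only [simsunList, mem_singleton, IsSimsun, range'_zero, perm_nil]
    constructor
    · exact fun h => ⟨h, by omega⟩
    · exact fun h => h.1
  | succ m ih => simp [simsunList, isSimsun_succ_iff, ih]

theorem nodup_simsunList (m : ℕ) : (simsunList m).Nodup := by
  induction m with
  | zero => simp [simsunList]
  | succ m ih =>
    rw [simsunList, nodup_flatMap]
    constructor
    · intro l hl
      refine (nodup_permutations'Aux_of_notMem _ _ fun h => ?_).filter _
      exact absurd ((mem_simsunList.1 hl).lt _ h) (by simp)
    · refine ih.imp_of_mem fun {l₁ l₂} h₁ h₂ hne w hw₁ hw₂ => hne ?_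
      obtain ⟨u₁, v₁, rfl, rfl⟩ := mem_permutations'Aux_iff.1 (mem_of_mem_filter hw₁)
      obtain ⟨u₂, v₂, rfl, h⟩ := mem_permutations'Aux_iff.1 (mem_of_mem_filter hw₂)
      have hf : ∀ u v : List ℕ, u ++ v ∈ simsunList m →
          (u ++ (m + 1) :: v).filter (fun x => decide (x < m + 1)) = u ++ v := fun u v huv => by
        rw [filter_append, filter_cons_of_neg (by simp), ← filter_append]
        exact filter_eq_self.2 (by simpa using (mem_simsunList.1 huv).lt)
      rw [← hf _ _ h₁, h, hf _ _ h₂]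

theorem sum_descentWeight_simsunList {A R : Type*} [CommSemiring A] [CommRing R] [Algebra A R]
    (D : Derivation A R R)
    {x y : R} (hx : D x = x * y) (hy : D y = x) (m : ℕ) :
    ((simsunList m).map (descentWeight x y)).sum = D^[m] x := by
  induction m with
  | zero => simp [simsunList, descentWeight]
  | succ m ih =>
    rw [simsunList, map_flatMap, Function.iterate_succ_apply', ← ih, map_list_sum, map_map,
      flatMap_def, sum_flatten, map_map]
    refine congrArg _ (map_congr_left fun l hl => ?_)
    have h := mem_simsunList.1 hl
    exact sum_descentWeight_permutations'Aux D hx hy _ l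
      (h.1.nodup_iff.2 nodup_range') h.lt h.not_hasDoubleDescent

end Simsun

section DownUp

open Finset

theorem downUpWord_append_cons_iff {m : ℕ} {u v : List ℕ} (hu : ∀ a ∈ u, m < a)
    (hv : ∀ a ∈ v, m < a) (hodd : Odd u.length) :
    DownUpWord (u ++ m :: v) ↔ DownUpWord u ∧ DownUpWord v := by
  rw [Nat.odd_iff] at hodd
  simp only [DownUpWord, List.get_eq_getElem]
  constructor
  · refine fun h => ⟨fun i hi => ?_, fun i hi => ?_⟩
    · have := h i (by simp; omega)
      rwa [List.getElem_append_left hi,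
        List.getElem_append_left (by omega : i < u.length)] at this
    · have := h (u.length + (i + 1)) (by simp; omega)
      simp only [add_assoc u.length, List.getElem_append_right (Nat.le_add_right _ _),
        Nat.add_sub_cancel_left, List.getElem_cons_succ] at this
      exact ⟨fun hi2 => this.1 (by omega), fun hi2 => this.2 (by omega)⟩
  · rintro ⟨h₁, h₂⟩ i hi
    rcases lt_trichotomy (i + 1) u.length with hlt | heq | hgt
    · rw [List.getElem_append_left hlt, List.getElem_append_left (by omega : i < u.length)]
      exact h₁ i hlt
    · refine ⟨fun _ => ?_, by omega⟩
      rw [List.getElem_append_left (by omega : i < u.length),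
        List.getElem_append_right (by omega : u.length ≤ i + 1)]
      simpa [heq] using hu _ (List.getElem_mem _)
    · obtain ⟨j, rfl⟩ : ∃ j, i = u.length + j := ⟨i - u.length, by omega⟩
      simp only [add_assoc u.length, List.getElem_append_right (Nat.le_add_right _ _),
        Nat.add_sub_cancel_left, List.getElem_cons_succ]
      simp only [List.length_append, List.length_cons] at hi
      rcases j with _ | j
      · refine ⟨by omega, fun _ => ?_⟩
        simpa using hv _ (List.getElem_mem _)
      · have := h₂ j (by omega)
        simp only [List.getElem_cons_succ]
        exact ⟨fun hi2 => this.1 (by omega), fun hi2 => this.2 (by omega)⟩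

theorem DownUpWord.odd_length {m : ℕ} {u v : List ℕ} (hu : ∀ a ∈ u, m < a)
    (hv : ∀ a ∈ v, m < a) (hne : u ++ v ≠ []) (h : DownUpWord (u ++ m :: v)) :
    Odd u.length := by
  rw [Nat.odd_iff]
  by_contra hodd
  simp only [DownUpWord, List.get_eq_getElem] at h
  rcases v with _ | ⟨b, v⟩
  · have hpos : 0 < u.length := List.length_pos_iff.2 (by simpa using hne)
    have := (h (u.length - 1) (by simp; omega)).2 (by omega)
    rw [List.getElem_append_left (by omega), List.getElem_append_right (by omega)] at this
    simp only [Nat.sub_add_cancel hpos, Nat.sub_self, List.getElem_cons_zero] at this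
    exact this.not_gt (hu _ (List.getElem_mem _))
  · have := (h u.length (by simp)).1 (by omega)
    simp only [List.getElem_append_right (Nat.le_add_right _ _), List.getElem_append_right le_rfl,
      Nat.add_sub_cancel_left, Nat.sub_self, List.getElem_cons_succ,
      List.getElem_cons_zero] at this
    exact this.not_gt (hv b (by simp))

open Classical in
/-- The down-up alternating arrangements of a finite set of numbers. -/
noncomputable def downUpWords (s : Finset ℕ) : Finset (List ℕ) :=
  {l ∈ s.toList.permutations.toFinset | DownUpWord l}

theorem mem_downUpWords {s : Finset ℕ} {l : List ℕ} :
    l ∈ downUpWords s ↔ l.Nodup ∧ l.toFinset = s ∧ DownUpWord l := by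
  classical
  rw [downUpWords, mem_filter, List.mem_toFinset, List.mem_permutations, ← and_assoc]
  refine and_congr_left fun _ => ⟨fun h => ?_, ?_⟩
  · exact ⟨h.nodup_iff.2 s.nodup_toList, by rw [List.toFinset_eq_of_perm _ _ h, toList_toFinset]⟩
  · rintro ⟨h, rfl⟩
    exact (List.toFinset_toList h).symm

theorem downUpWord_of_length_le_one {l : List ℕ} (hl : l.length ≤ 1) : DownUpWord l :=
  fun i hi => by omega

theorem downUpWords_empty : downUpWords ∅ = {[]} := by
  ext l
  rw [mem_downUpWords, List.toFinset_eq_empty_iff, mem_singleton]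
  constructor
  · tauto
  · rintro rfl
    exact ⟨List.nodup_nil, rfl, downUpWord_of_length_le_one (by simp)⟩

theorem card_downUpWords_singleton (m : ℕ) : #(downUpWords {m}) = 1 := by
  rw [card_eq_one]
  refine ⟨[m], ?_⟩
  ext l
  rw [mem_downUpWords, mem_singleton]
  constructor
  · rintro ⟨h, h', -⟩
    have := List.toFinset_toList h
    rw [h', toList_singleton] at this
    exact List.perm_singleton.1 this.symm
  · rintro rfl
    exact ⟨List.nodup_singleton m, by simp, downUpWord_of_length_le_one (by simp)⟩

/-- Splitting a down-up alternating word at its least entry. -/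
theorem card_downUpWords_insert {m : ℕ} {s : Finset ℕ} (hm : ∀ a ∈ s, m < a)
    (hs : s.Nonempty) :
    #(downUpWords (insert m s)) =
      ∑ t ∈ s.powerset with Odd #t, #(downUpWords t) * #(downUpWords (s \ t)) := by
  have hms : m ∉ s := fun h => (hm m h).false
  simp_rw [← card_product]
  rw [← card_sigma]
  symm
  refine card_bij (fun p _ => p.2.1 ++ m :: p.2.2) ?_ ?_ ?_
  · rintro ⟨t, u, v⟩ h
    simp only [mem_sigma, mem_filter, mem_powerset, mem_product, mem_downUpWords] at h ⊢
    obtain ⟨⟨hts, hodd⟩, ⟨hu, rfl, hu'⟩, hv, hvs, hv'⟩ := h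
    have hum : ∀ a ∈ u, a ∈ s := fun a ha => hts (List.mem_toFinset.2 ha)
    have hvm : ∀ a ∈ v, a ∈ s ∧ a ∉ u := fun a ha => by
      have := hvs ▸ List.mem_toFinset.2 ha
      simpa using this
    refine ⟨?_, ?_, ?_⟩
    · rw [List.nodup_middle, List.nodup_cons, List.nodup_append']
      refine ⟨?_, hu, hv, fun a ha ha' => (hvm a ha').2 ha⟩
      rw [List.mem_append]
      rintro (h | h)
      exacts [hms (hum _ h), hms (hvm _ h).1]
    · rw [List.toFinset_append, List.toFinset_cons, hvs, union_insert,
        union_sdiff_of_subset hts]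
    · rw [List.toFinset_card_of_nodup hu] at hodd
      exact (downUpWord_append_cons_iff (fun a ha => hm a (hum a ha))
        (fun a ha => hm a (hvm a ha).1) hodd).2 ⟨hu', hv'⟩
  · rintro ⟨t, u, v⟩ h ⟨t', u', v'⟩ h' heq
    simp only [mem_sigma, mem_filter, mem_powerset, mem_product, mem_downUpWords] at h h' heq
    obtain ⟨⟨hts, -⟩, ⟨-, rfl, -⟩, -, hvs, -⟩ := h
    obtain ⟨-, ⟨-, rfl, -⟩, -⟩ := h'
    rw [List.append_cons_inj_of_notMem] at heq
    · obtain ⟨rfl, -, rfl⟩ := heq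
      rfl
    · exact fun h => hms (hts (List.mem_toFinset.2 h))
    · exact fun h => hms (sdiff_subset (hvs ▸ List.mem_toFinset.2 h))
  · intro l h
    rw [mem_downUpWords] at h
    obtain ⟨hl, hls, hdu⟩ := h
    obtain ⟨u, v, rfl⟩ := List.append_of_mem
      (List.mem_toFinset.1 (hls ▸ mem_insert_self m s) : m ∈ l)
    rw [List.nodup_middle, List.nodup_cons, List.nodup_append'] at hl
    obtain ⟨hmuv, hu, hv, huv⟩ := hl
    have hs' : s = u.toFinset ∪ v.toFinset := by
      rw [← erase_insert hms, ← hls]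
      ext a
      simp only [List.mem_append] at hmuv
      simp
      grind
    subst hs'
    have hum : ∀ a ∈ u, m < a := fun a ha => hm a (by simp [ha])
    have hvm : ∀ a ∈ v, m < a := fun a ha => hm a (by simp [ha])
    have hodd := hdu.odd_length hum hvm (by
      rintro h
      simp_all)
    have hdu' := (downUpWord_append_cons_iff hum hvm hodd).1 hdu
    refine ⟨⟨u.toFinset, u, v⟩, ?_, rfl⟩
    simp only [mem_sigma, mem_filter, mem_powerset, mem_product, mem_downUpWords]
    refine ⟨⟨subset_union_left, by rwa [List.toFinset_card_of_nodup hu]⟩, ⟨hu, trivial, hdu'.1⟩, hv,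
      ?_, hdu'.2⟩
    rw [union_sdiff_cancel_left]
    exact List.disjoint_toFinset_iff_disjoint.2 huv

end DownUp

section SecTan

open PowerSeries Finset

theorem derivative_sin : d⁄dX ℚ (sin ℚ) = cos ℚ := by
  ext n
  rw [coeff_derivative, sin, cos, coeff_mk, coeff_mk]
  by_cases hn : Even n
  · rw [if_neg (by simpa [Nat.even_add_one] using hn), if_pos hn,
      Nat.succ_div_of_not_dvd (by rw [← even_iff_two_dvd]; simpa [Nat.even_add_one] using hn),
      Nat.factorial_succ]
    simp only [Algebra.algebraMap_self, RingHom.id_apply]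
    push_cast
    field_simp
  · simp [hn, Nat.even_add_one]

theorem derivative_cos : d⁄dX ℚ (cos ℚ) = -sin ℚ := by
  ext n
  rw [coeff_derivative, map_neg, sin, cos, coeff_mk, coeff_mk]
  by_cases hn : Even n
  · simp [hn, Nat.even_add_one]
  · have hn' : Even (n + 1) := by simpa [Nat.even_add_one] using hn
    rw [if_pos hn', if_neg hn, Nat.succ_div_of_dvd (even_iff_two_dvd.1 hn'), Nat.factorial_succ]
    simp only [Algebra.algebraMap_self, RingHom.id_apply]
    push_cast
    field_simp
    ring

theorem constantCoeff_sin : constantCoeff (sin ℚ) = 0 := by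
  simp [sin, ← coeff_zero_eq_constantCoeff_apply]

theorem constantCoeff_cos : constantCoeff (cos ℚ) = 1 := by
  simp [cos, ← coeff_zero_eq_constantCoeff_apply]

theorem sin_sq_add_cos_sq : sin ℚ ^ 2 + cos ℚ ^ 2 = 1 := by
  refine derivative.ext ?_ ?_
  · simp only [map_add, derivative_pow, derivative_sin, derivative_cos, derivative_one]
    ring
  · simp [constantCoeff_sin, constantCoeff_cos]

/-- The power series of the secant at zero. -/
noncomputable def secSeries : ℚ⟦X⟧ := (cos ℚ)⁻¹

/-- The power series of the tangent at zero. -/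
noncomputable def tanSeries : ℚ⟦X⟧ := sin ℚ * (cos ℚ)⁻¹

theorem cos_mul_secSeries : cos ℚ * secSeries = 1 :=
  PowerSeries.mul_inv_cancel _ (by simp [constantCoeff_cos])

theorem secSeries_sq : secSeries ^ 2 = 1 + tanSeries ^ 2 := by
  have h := cos_mul_secSeries
  rw [tanSeries, ← secSeries]
  linear_combination (-secSeries ^ 2) * sin_sq_add_cos_sq + (cos ℚ * secSeries + 1) * h

theorem derivative_secSeries : d⁄dX ℚ secSeries = secSeries * tanSeries := by
  rw [secSeries, derivative_inv', derivative_cos, tanSeries]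
  ring

theorem derivative_tanSeries : d⁄dX ℚ tanSeries = secSeries ^ 2 := by
  have h := cos_mul_secSeries
  have h' := derivative_secSeries
  rw [secSeries_sq, tanSeries, ← secSeries, Derivation.leibniz, h', derivative_sin]
  simp only [smul_eq_mul]
  rw [tanSeries, ← secSeries]
  linear_combination h

theorem constantCoeff_secSeries : constantCoeff secSeries = 1 := by
  simp [secSeries, constantCoeff_inv, constantCoeff_cos]

theorem constantCoeff_tanSeries : constantCoeff tanSeries = 0 := by
  simp [tanSeries, constantCoeff_sin]

theorem coeff_tanSeries_of_even {n : ℕ} (hn : Even n) : coeff n tanSeries = 0 := by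
  induction n using Nat.strong_induction_on with
  | _ n ih =>
    rcases n with _ | n
    · simp [constantCoeff_tanSeries]
    · have hn' : ¬ Even n := by simpa [Nat.even_add_one] using hn
      have h := congrArg (coeff n) (derivative_tanSeries.trans secSeries_sq)
      rw [coeff_derivative, map_add, coeff_one, if_neg (by rintro rfl; simp at hn'), sq, coeff_mul,
        sum_eq_zero, add_zero] at h
      · exact (mul_eq_zero.1 h).resolve_right (by positivity)
      · rintro ⟨i, j⟩ hij
        rw [HasAntidiagonal.mem_antidiagonal] at hij
        simp only at hij ⊢
        rcases Nat.even_or_odd i with hi | hi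
        · rw [ih i (by omega) hi, zero_mul]
        · rw [ih j (by omega) (by rw [← hij, Nat.even_add] at hn'; grind), mul_zero]

theorem coeff_secSeries_of_odd {n : ℕ} (hn : Odd n) : coeff n secSeries = 0 := by
  induction n using Nat.strong_induction_on with
  | _ n ih =>
    rcases n with _ | n
    · simp at hn
    · have hn' : Even n := by simpa [Nat.odd_add_one] using hn
      have h := congrArg (coeff n) derivative_secSeries
      rw [coeff_derivative, coeff_mul, sum_eq_zero] at h
      · exact (mul_eq_zero.1 h).resolve_right (by positivity)
      · rintro ⟨i, j⟩ hij
        rw [HasAntidiagonal.mem_antidiagonal] at hij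
        simp only at hij ⊢
        rcases Nat.even_or_odd i with hi | hi
        · rw [coeff_tanSeries_of_even (by rw [← hij, Nat.even_add] at hn'; tauto), mul_zero]
        · rw [ih i (by omega) hi, zero_mul]

theorem derivative_secSeries_add_tanSeries :
    d⁄dX ℚ (secSeries + tanSeries) = 1 + tanSeries * (secSeries + tanSeries) := by
  rw [map_add, derivative_secSeries, derivative_tanSeries, secSeries_sq]
  ring

theorem coeff_tanSeries (n : ℕ) :
    coeff n tanSeries = if Odd n then coeff n (secSeries + tanSeries) else 0 := by
  split_ifs with hn
  · rw [map_add, coeff_secSeries_of_odd hn, zero_add]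
  · exact coeff_tanSeries_of_even (Nat.not_odd_iff_even.1 hn)

/-- The recurrence for the coefficients of `sec + tan`, in terms of subsets of a finite set. -/
theorem factorial_mul_coeff_succ_secSeries_add_tanSeries {s : Finset ℕ} (hs : s.Nonempty) :
    ((#s + 1).factorial : ℚ) * coeff (#s + 1) (secSeries + tanSeries) =
      ∑ t ∈ s.powerset with Odd #t,
        ((#t).factorial * coeff #t (secSeries + tanSeries)) *
          ((#(s \ t)).factorial * coeff #(s \ t) (secSeries + tanSeries)) := by
  have h := congrArg (coeff #s) derivative_secSeries_add_tanSeries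
  rw [coeff_derivative, map_add _ 1, coeff_one, if_neg hs.card_pos.ne', zero_add, coeff_mul,
    Nat.sum_antidiagonal_eq_sum_range_succ_mk] at h
  rw [Nat.factorial_succ, sum_filter]
  push_cast
  rw [mul_right_comm, mul_comm ((#s : ℚ) + 1), h, sum_mul]
  set c := fun n => coeff n (secSeries + tanSeries)
  trans ∑ k ∈ range (#s + 1), (#s).choose k • if Odd k then
      (k.factorial * c k) * ((#s - k).factorial * c (#s - k)) else (0 : ℚ)
  · refine sum_congr rfl fun k hk => ?_
    rw [coeff_tanSeries, nsmul_eq_mul,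
      ← Nat.choose_mul_factorial_mul_factorial (Nat.lt_succ_iff.1 (mem_range.1 hk))]
    split_ifs
    · push_cast
      ring
    · simp
  · rw [← sum_powerset_apply_card]
    refine sum_congr rfl fun t ht => ?_
    rw [card_sdiff_of_subset (mem_powerset.1 ht)]

theorem card_downUpWords (s : Finset ℕ) :
    (#(downUpWords s) : ℚ) = (#s).factorial * coeff #s (secSeries + tanSeries) := by
  induction s using Finset.strongInduction with
  | _ s ih =>
    rcases s.eq_empty_or_nonempty with rfl | hs
    · simp [downUpWords_empty, constantCoeff_secSeries, constantCoeff_tanSeries]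
    obtain ⟨m, s', hms, rfl, hm⟩ : ∃ m s', m ∉ s' ∧ insert m s' = s ∧ ∀ a ∈ s', m < a :=
      ⟨s.min' hs, s.erase (s.min' hs), notMem_erase _ _, insert_erase (min'_mem _ _),
        fun a ha => min'_lt_of_mem_erase_min' _ _ ha⟩
    rw [card_insert_of_notMem hms]
    rcases s'.eq_empty_or_nonempty with rfl | hs'
    · have h := congrArg (coeff 0) derivative_secSeries_add_tanSeries
      rw [coeff_derivative] at h
      simpa [card_downUpWords_singleton, constantCoeff_tanSeries] using h.symm
    · rw [card_downUpWords_insert hm hs', factorial_mul_coeff_succ_secSeries_add_tanSeries hs']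
      push_cast
      refine sum_congr rfl fun t ht => ?_
      have hts := mem_powerset.1 (mem_filter.1 ht).1
      rw [ih t (hts.trans_ssubset (ssubset_insert hms)),
        ih (s' \ t) (sdiff_subset.trans_ssubset (ssubset_insert hms))]

theorem length_simsunList (m : ℕ) :
    ((simsunList m).length : ℚ) = (m + 1).factorial * coeff (m + 1) (secSeries + tanSeries) := by
  have hy : d⁄dX ℚ (secSeries + tanSeries) = secSeries * (secSeries + tanSeries) := by
    rw [map_add, derivative_secSeries, derivative_tanSeries]
    ring
  have hx : d⁄dX ℚ (secSeries * (secSeries + tanSeries)) =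
      secSeries * (secSeries + tanSeries) * (secSeries + tanSeries) := by
    rw [Derivation.leibniz, hy, derivative_secSeries]
    simp only [smul_eq_mul]
    ring
  have h := congrArg constantCoeff (sum_descentWeight_simsunList (d⁄dX ℚ) hx hy m)
  rw [← hy, ← Function.iterate_succ_apply, constantCoeff_iterate_derivative, hy, map_list_sum,
    List.map_map] at h
  have hone : constantCoeff ∘ descentWeight (secSeries * (secSeries + tanSeries))
      (secSeries + tanSeries) = fun _ => (1 : ℚ) := by
    ext l
    simp [map_descentWeight, constantCoeff_secSeries, constantCoeff_tanSeries,
      descentWeight_one_one]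
  rw [hone] at h
  simpa using h

end SecTan

/-- The number of Simsun permutations of `[n-1]` equals the number of down-up
alternating permutations of `[n]`. -/
theorem card_simsun_eq_card_downUp (n : ℕ) (hn : 1 ≤ n) :
    Nat.card {l : List ℕ // IsSimsun (n - 1) l}
      = Nat.card {l : List ℕ // l.Perm (List.range' 1 n) ∧ DownUpWord l} := by
  obtain ⟨m, rfl⟩ := Nat.exists_eq_add_of_le' hn
  rw [Nat.add_sub_cancel,
    Nat.subtype_card (simsunList m).toFinset (by simp [mem_simsunList]),
    Nat.subtype_card (downUpWords (Finset.Icc 1 (m + 1))),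
    List.toFinset_card_of_nodup (nodup_simsunList m), ← Nat.cast_inj (R := ℚ), card_downUpWords,
    length_simsunList, Nat.card_Icc, Nat.add_sub_cancel]
  intro l
  have hrange : (List.range' 1 (m + 1)).toFinset = Finset.Icc 1 (m + 1) := by
    ext a
    simp
    omega
  rw [mem_downUpWords, ← and_assoc, ← hrange]
  refine and_congr_left fun _ => ⟨fun ⟨hl, hls⟩ => ?_, fun h => ?_⟩
  · exact List.perm_of_nodup_nodup_toFinset_eq hl List.nodup_range' hls
  · exact ⟨h.nodup_iff.2 List.nodup_range', List.toFinset_eq_of_perm _ _ h⟩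
end

section
/- For all integers n ≥ 1 and all integers k with 1 ≤ |k| ≤ n, the number of signed André permutations of [n] whose last entry is k equals the number of down-up alternating permutations of type B_n whose first entry is k; that is, #DA^B_{n,k} = #DU^B_{n,k}. -/
/-- A word ends with an ascent if it has length 1 or its last two letters increase. -/
def EndsWithAscent {α : Type*} [LT α] (w : List α) : Prop :=
  w.length = 1 ∨ ∃ h : 2 ≤ w.length,
    w.get ⟨w.length - 2, by omega⟩ < w.get ⟨w.length - 1, by omega⟩

/-- Signed permutation of `[n]`: the absolute values form a permutation of `1, …, n`. -/
def IsSignedPerm (n : ℕ) (l : List ℤ) : Prop :=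
  (l.map Int.natAbs).Perm (List.range' 1 n)

/-- The subword of `l` consisting of its `k` smallest entries (in the order of `l`). -/
def lowerSubword (l : List ℤ) (k : ℕ) : List ℤ :=
  l.filter (fun x => decide (l.countP (fun y => decide (y ≤ x)) ≤ k))

/-- Signed André permutation of `[n]`: every subword consisting of the `k` smallest
entries has no double descents and ends with an ascent. -/
def IsSignedAndre (n : ℕ) (l : List ℤ) : Prop :=
  IsSignedPerm n l ∧
  ∀ k : ℕ, 1 ≤ k → k ≤ n →
    ¬ HasDoubleDescent (lowerSubword l k) ∧ EndsWithAscent (lowerSubword l k)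

/-- The Entringer numbers: `entringer p q` counts the down-up arrangements of `p + q + 1` letters
whose first letter exceeds exactly `p` of the others. -/
def entringer : ℕ → ℕ → ℕ
  | 0, 0 => 1
  | 0, _ + 1 => 0
  | p + 1, q => entringer p (q + 1) + entringer q p
termination_by p q => (p + q, p)
decreasing_by all_goals (simp only [Prod.lex_def]; omega)

theorem entringer_zero_zero : entringer 0 0 = 1 := by simp [entringer]

theorem entringer_zero_succ (q : ℕ) : entringer 0 (q + 1) = 0 := by simp [entringer]

theorem entringer_succ (p q : ℕ) :
    entringer (p + 1) q = entringer p (q + 1) + entringer q p := by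
  rw [entringer]

/-- The number of ways of inserting `r` successive new maxima, never at the end, into an André
word with `d` descents and `a + 2 * d + 1` letters. -/
def completions : ℕ → ℕ → ℕ → ℕ
  | 0, _, _ => 1
  | r + 1, a, d => d * completions r (a + 1) d + a * completions r (a - 1) (d + 1)

/-- Summation of a statistic over the words obtained by inserting a new maximum into an André
word with `d` descents and `a + 2 * d + 1` letters. -/
def insertSum (φ : ℕ → ℕ → ℕ) (a d : ℕ) : ℕ :=
  (d + 1) * φ (a + 1) d + a * φ (a - 1) (d + 1)

theorem completions_add_two (r a d : ℕ) :
    completions r (a + 2) d + completions r a d = 2 * completions r a (d + 1) := by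
  induction r generalizing a d with
  | zero => rfl
  | succ r ih =>
    cases a with
    | zero =>
      have h := ih 1 d
      simp only [completions, zero_add, zero_mul, add_zero] at h ⊢
      linear_combination d * h
    | succ a =>
      have h := ih (a + 2) d
      have h' := ih a (d + 1)
      simp only [completions, Nat.add_sub_cancel, show a + 1 + 2 - 1 = a + 2 from rfl,
        show a + 1 + 2 + 1 = a + 2 + 2 from rfl, show a + 1 + 1 = a + 2 from rfl] at h h' ⊢
      linear_combination d * h + (a + 1) * h'

theorem insertSum_add (φ ψ : ℕ → ℕ → ℕ) :
    insertSum (φ + ψ) = insertSum φ + insertSum ψ := by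
  funext a d
  simp only [insertSum, Pi.add_apply]
  ring

theorem iterate_insertSum_add (m : ℕ) (φ ψ : ℕ → ℕ → ℕ) :
    insertSum^[m] (φ + ψ) = insertSum^[m] φ + insertSum^[m] ψ := by
  induction m generalizing φ ψ with
  | zero => rfl
  | succ m ih => simp only [Function.iterate_succ_apply, insertSum_add, ih]

/-- The number of André words of `p + q + 1` letters whose last letter exceeds exactly `p` of
the others. -/
def andreNumber : ℕ → ℕ → ℕ
  | 0, q => completions q 0 0
  | p + 1, q => insertSum^[p] (fun a d => completions q (a + 1) d) 0 0

theorem andreNumber_succ_succ (p q : ℕ) :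
    andreNumber (p + 1 + 1) q + insertSum^[p] (fun a d => completions q a d) 0 0 =
      andreNumber (p + 1) (q + 1) + insertSum^[p] (fun a d => completions q a (d + 1)) 0 0 := by
  have key : insertSum (fun a d => completions q (a + 1) d) + (fun a d => completions q a d) =
      (fun a d => completions (q + 1) (a + 1) d) + (fun a d => completions q a (d + 1)) := by
    funext a d
    have h := completions_add_two q a d
    have h' : a * completions q (a - 1 + 1) (d + 1) = a * completions q a (d + 1) := by
      cases a <;> simp
    simp only [insertSum, Pi.add_apply, completions, Nat.add_sub_cancel, h']
    linear_combination h
  have h := congrFun (congrFun (congrArg insertSum^[p] key) 0) 0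
  rw [iterate_insertSum_add, iterate_insertSum_add] at h
  exact h

theorem iterate_insertSum_completions_succ (p q : ℕ) :
    insertSum^[p + 1] (fun a d => completions q a d) 0 0 =
      insertSum^[p] (fun a d => completions (q + 1) a d) 0 0 + andreNumber (p + 1) q := by
  have key : insertSum (fun a d => completions q a d) =
      (fun a d => completions (q + 1) a d) + (fun a d => completions q (a + 1) d) := by
    funext a d
    simp only [insertSum, Pi.add_apply, completions]
    ring
  rw [Function.iterate_succ_apply, key, iterate_insertSum_add]
  rfl

theorem insertSum_completions (q : ℕ) :
    insertSum (fun a d => completions q a (d + 1)) = fun a d => completions (q + 1) a (d + 1) :=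
  rfl

theorem andreNumber_eq_entringer_and (N : ℕ) :
    (∀ p q, p + q = N → andreNumber p q = entringer p q) ∧
      ∀ q p, p + 1 + q = N →
        insertSum^[p] (fun a d => completions q a (d + 1)) 0 0 =
          insertSum^[p] (fun a d => completions q a d) 0 0 + entringer q (p + 1) := by
  induction N with
  | zero =>
    refine ⟨fun p q h => ?_, fun q p h => by omega⟩
    obtain ⟨rfl, rfl⟩ : p = 0 ∧ q = 0 := by omega
    simp [andreNumber, completions, entringer]
  | succ N ih =>
    obtain ⟨ih₁, ih₂⟩ := ih
    constructor
    · intro p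
      induction p with
      | zero =>
        rintro (_ | q) h
        · omega
        · simp [andreNumber, completions, entringer]
      | succ p ih =>
        intro q h
        cases p with
        | zero =>
          cases q with
          | zero => simp [andreNumber, completions, entringer]
          | succ q =>
            have h₂ := ih₂ q 0 (by omega)
            have h₃ : completions q 0 0 = entringer 0 q := by
              cases q <;> simp [completions, entringer]
            have h₄ := entringer_succ q 0
            have h₅ := entringer_succ 0 (q + 1)
            have h₆ := entringer_zero_succ (q + 1)
            have h₇ : completions (q + 1) 1 0 = completions q 0 1 := by simp [completions]
            simp only [Function.iterate_zero, id, zero_add] at h₂ h₄ h₅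
            simp only [andreNumber, Function.iterate_zero, id, zero_add]
            omega
        | succ p =>
          have h₁ := andreNumber_succ_succ p q
          have h₂ := ih₂ q p (by omega)
          have h₃ := ih (q + 1) (by omega)
          have h₄ := entringer_succ (p + 1) q
          omega
    · intro q
      induction q with
      | zero => intro p _; simp [completions, entringer]
      | succ q ih =>
        intro p h
        have h₁ := ih (p + 1) (by omega)
        have h₂ := ih₁ (p + 1) q (by omega)
        have h₃ := iterate_insertSum_completions_succ p q
        rw [Function.iterate_succ_apply, insertSum_completions] at h₁
        have h₄ := entringer_succ q (p + 1)
        omega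

theorem andreNumber_eq_entringer (p q : ℕ) : andreNumber p q = entringer p q :=
  (andreNumber_eq_entringer_and (p + q)).1 p q rfl

section Words

variable {α : Type*} [LinearOrder α]

/-- The words using each letter of `S` exactly once. -/
def arrangements (S : Finset α) : Finset (List α) :=
  S.val.lists.toFinset

theorem mem_arrangements {S : Finset α} {l : List α} :
    l ∈ arrangements S ↔ l.Nodup ∧ l.toFinset = S := by
  rw [arrangements, Multiset.mem_toFinset, Multiset.mem_lists_iff]
  constructor
  · intro h
    have hl : l.Nodup := by
      have := S.nodup
      rw [h] at this
      exact this
    refine ⟨hl, ?_⟩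
    ext x
    rw [List.mem_toFinset, ← Finset.mem_val, h]
    rfl
  · rintro ⟨hl, rfl⟩
    rw [List.toFinset_val, hl.dedup]
    rfl

theorem arrangements_empty : arrangements (∅ : Finset α) = {[]} := by
  ext l
  rw [mem_arrangements, Finset.mem_singleton, List.toFinset_eq_empty_iff]
  exact ⟨fun h => h.2, fun h => ⟨h ▸ List.nodup_nil, h⟩⟩

theorem length_of_mem_arrangements {S : Finset α} {l : List α} (h : l ∈ arrangements S) :
    l.length = S.card := by
  obtain ⟨hl, rfl⟩ := mem_arrangements.1 h
  rw [List.toFinset_card_of_nodup hl]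

theorem cons_mem_arrangements {S : Finset α} {k : α} {l : List α} :
    k :: l ∈ arrangements S ↔ k ∈ S ∧ l ∈ arrangements (S.erase k) := by
  simp only [mem_arrangements, List.nodup_cons, List.toFinset_cons]
  constructor
  · rintro ⟨⟨hk, hl⟩, rfl⟩
    exact ⟨Finset.mem_insert_self _ _, hl, by
      rw [Finset.erase_insert (by rwa [List.mem_toFinset])]⟩
  · rintro ⟨hk, hl, h⟩
    refine ⟨⟨fun hk' => ?_, hl⟩, by rw [h, Finset.insert_erase hk]⟩
    rw [← List.mem_toFinset, h] at hk'
    exact Finset.notMem_erase _ _ hk'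

/-- The order relation `y < x` (a down step) or `x < y` (an up step). -/
def Step (b : Bool) (x y : α) : Prop :=
  if b then y < x else x < y

instance (b : Bool) (x y : α) : Decidable (Step b x y) :=
  inferInstanceAs (Decidable (if b then y < x else x < y))

theorem Step.trans {b : Bool} {x y z : α} (h : Step b x y) (h' : Step b y z) : Step b x z := by
  cases b
  · exact lt_trans (α := α) h h'
  · exact lt_trans (α := α) h' h

theorem Step.ne {b : Bool} {x y : α} (h : Step b x y) : x ≠ y := by
  cases b
  · exact ne_of_lt (α := α) h
  · exact ne_of_gt (α := α) h

theorem not_step_self (b : Bool) (x : α) : ¬ Step b x x := fun h => h.ne rfl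

theorem step_not_iff {b : Bool} {x y : α} : Step (!b) x y ↔ y ≠ x ∧ ¬ Step b x y := by
  cases b
  · simp only [Step, Bool.not_false, if_true, Bool.false_eq_true, if_false, not_lt]
    exact lt_iff_le_and_ne.trans and_comm
  · simp only [Step, Bool.not_true, if_true, Bool.false_eq_true, if_false, not_lt]
    exact lt_iff_le_and_ne.trans (and_comm.trans (and_congr_left' ne_comm))

/-- Alternating words, starting with a down step if `b` and with an up step otherwise. -/
def Alternating : Bool → List α → Prop
  | _, [] => True
  | _, [_] => True
  | b, x :: y :: l => Step b x y ∧ Alternating (!b) (y :: l)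

theorem card_step_add_card_step_not {S : Finset α} {k : α} (hk : k ∈ S) (b : Bool) :
    (S.filter (Step b k)).card + (S.filter (Step (!b) k)).card + 1 = S.card := by
  have h₁ : S.filter (Step b k) = (S.erase k).filter (Step b k) := by
    ext x
    simp only [Finset.mem_filter, Finset.mem_erase]
    exact ⟨fun h => ⟨⟨h.2.ne.symm, h.1⟩, h.2⟩, fun h => ⟨h.1.2, h.2⟩⟩
  have h₂ : S.filter (Step (!b) k) = (S.erase k).filter (fun x => ¬ Step b k x) := by
    ext x
    simp only [Finset.mem_filter, Finset.mem_erase, step_not_iff]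
    tauto
  rw [h₁, h₂, Finset.card_filter_add_card_filter_not, Finset.card_erase_add_one hk]

theorem sum_card_filter_step (b : Bool) (T : Finset α) (h : ℕ → ℕ) :
    ∑ c ∈ T, h (T.filter (Step b c)).card = ∑ i ∈ Finset.range T.card, h i := by
  have key (a : α) (s : Finset α) (ha : ∀ x ∈ s, Step b a x)
      (ih : ∑ c ∈ s, h (s.filter (Step b c)).card = ∑ i ∈ Finset.range s.card, h i) :
      ∑ c ∈ insert a s, h ((insert a s).filter (Step b c)).card =
        ∑ i ∈ Finset.range (insert a s).card, h i := by
    have has : a ∉ s := fun h' => not_step_self b a (ha a h')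
    rw [Finset.sum_insert has, Finset.card_insert_of_notMem has, Finset.sum_range_succ, ← ih,
      add_comm]
    congr 1
    · refine Finset.sum_congr rfl fun c hc => ?_
      rw [Finset.filter_insert, if_neg fun h' => not_step_self b a ((ha c hc).trans h')]
    · rw [Finset.filter_insert, if_neg (not_step_self b a), Finset.filter_true_of_mem ha]
  cases b with
  | false => exact Finset.induction_on_min T (by simp) fun a s ha ih => key a s ha ih
  | true => exact Finset.induction_on_max T (by simp) fun a s ha ih => key a s ha ih

theorem entringer_eq_sum (p q : ℕ) (h : p + q ≠ 0) :
    entringer p q = ∑ i ∈ Finset.range p, entringer (p + q - 1 - i) i := by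
  induction p generalizing q with
  | zero =>
    obtain ⟨q, rfl⟩ := Nat.exists_eq_succ_of_ne_zero (by simpa using h : q ≠ 0)
    simp [entringer_zero_succ]
  | succ p ih =>
    rw [entringer_succ, ih (q + 1) (by omega), Finset.sum_range_succ]
    congr 2
    · simp only [Nat.add_right_comm p 1 q, Nat.add_assoc]
    · omega

open Classical in
/-- Alternating words are counted by the Entringer numbers. -/
theorem card_alternating (b : Bool) (S : Finset α) (k : α) (hk : k ∈ S) :
    ((arrangements S).filter fun l => Alternating b l ∧ l.head? = some k).card =
      entringer (S.filter (Step b k)).card (S.filter (Step (!b) k)).card := by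
  induction hn : S.card generalizing S k b with
  | zero => exact absurd hk (by rw [Finset.card_eq_zero.1 hn]; exact Finset.notMem_empty _)
  | succ n ih =>
    have hpq := card_step_add_card_step_not hk b
    have hcard : (S.erase k).card = n := by rw [Finset.card_erase_of_mem hk, hn]; rfl
    rcases Nat.eq_zero_or_pos n with rfl | hpos
    · have h₀ : S.erase k = ∅ := Finset.card_eq_zero.1 hcard
      have h₁ : ((arrangements S).filter fun l => Alternating b l ∧ l.head? = some k) = {[k]} := by
        ext l
        rw [Finset.mem_filter, Finset.mem_singleton]
        constructor
        · rintro ⟨hl, -, hhead⟩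
          obtain ⟨l', rfl⟩ := List.head?_eq_some_iff.1 hhead
          rw [cons_mem_arrangements, h₀, arrangements_empty, Finset.mem_singleton] at hl
          rw [hl.2]
        · rintro rfl
          exact ⟨by rw [cons_mem_arrangements, h₀, arrangements_empty]; simpa using hk,
            trivial, rfl⟩
      rw [h₁, Finset.card_singleton, show (S.filter (Step b k)).card = 0 by omega,
        show (S.filter (Step (!b) k)).card = 0 by omega, entringer_zero_zero]
    · have hsplit : ((arrangements S).filter fun l => Alternating b l ∧ l.head? = some k) =
          ((S.filter (Step b k)).biUnion fun c => (arrangements (S.erase k)).filter fun l =>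
            Alternating (!b) l ∧ l.head? = some c).image (List.cons k) := by
        ext l
        simp only [Finset.mem_filter, Finset.mem_image, Finset.mem_biUnion]
        constructor
        · rintro ⟨hl, halt, hhead⟩
          obtain ⟨l', rfl⟩ := List.head?_eq_some_iff.1 hhead
          rw [cons_mem_arrangements] at hl
          obtain _ | ⟨c, l'⟩ := l'
          · have := length_of_mem_arrangements hl.2
            simp at this
            omega
          · exact ⟨_, ⟨c, ⟨Finset.mem_of_mem_erase (cons_mem_arrangements.1 hl.2).1, halt.1⟩,
              hl.2, halt.2, rfl⟩, rfl⟩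
        · rintro ⟨l', ⟨c, ⟨hc, hkc⟩, hl', halt, hhead⟩, rfl⟩
          obtain ⟨l', rfl⟩ := List.head?_eq_some_iff.1 hhead
          exact ⟨cons_mem_arrangements.2 ⟨hk, hl'⟩, ⟨hkc, halt⟩, rfl⟩
      rw [hsplit, Finset.card_image_of_injective _ List.cons_injective, Finset.card_biUnion]
      · rw [entringer_eq_sum _ _ (by omega), ← sum_card_filter_step b]
        refine Finset.sum_congr rfl fun c hc => ?_
        rw [Finset.mem_filter] at hc
        have hc' : c ∈ S.erase k := Finset.mem_erase.2 ⟨hc.2.ne.symm, hc.1⟩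
        have h₁ := card_step_add_card_step_not hc' b
        have h₂ : (S.erase k).filter (Step b c) = (S.filter (Step b k)).filter (Step b c) := by
          ext x
          simp only [Finset.mem_filter, Finset.mem_erase]
          exact ⟨fun h => ⟨⟨h.1.2, hc.2.trans h.2⟩, h.2⟩,
            fun h => ⟨⟨h.1.2.ne.symm, h.1.1⟩, h.2⟩⟩
        rw [ih (!b) _ c hc' hcard, Bool.not_not, h₂]
        rw [h₂] at h₁
        congr 1
        omega
      · intro c _ c' _ hcc'
        rw [Function.onFun, Finset.disjoint_left]
        intro l hl hl'
        rw [Finset.mem_filter] at hl hl'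
        exact hcc' (Option.some.inj (hl.2.2.symm.trans hl'.2.2))

theorem alternating_iff_get (b : Bool) (l : List α) :
    Alternating b l ↔ ∀ i : ℕ, ∀ h : i + 1 < l.length,
      (i % 2 = 0 → Step b l[i] l[i + 1]) ∧ (i % 2 = 1 → Step (!b) l[i] l[i + 1]) := by
  induction l generalizing b with
  | nil => simp [Alternating]
  | cons x l ih =>
    cases l with
    | nil => simp [Alternating]
    | cons y l =>
      rw [Alternating, ih]
      constructor
      · rintro ⟨h₀, h⟩ (_ | i) hi
        · exact ⟨fun _ => h₀, by simp⟩
        · have h' := h i (by simpa using hi)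
          rw [Bool.not_not] at h'
          exact ⟨fun hp => h'.2 (by omega), fun hp => h'.1 (by omega)⟩
      · intro h
        refine ⟨(h 0 (by simp)).1 rfl, fun i hi => ?_⟩
        have h' := h (i + 1) (by simpa using hi)
        rw [Bool.not_not]
        exact ⟨fun hp => h'.2 (by omega), fun hp => h'.1 (by omega)⟩

theorem downUpWord_iff_alternating (l : List α) : DownUpWord l ↔ Alternating true l := by
  rw [alternating_iff_get]
  rfl

/-- A word without double descents that ends with an ascent, in recursive form. -/
def Tame : List α → Prop
  | [] => False
  | [_] => True
  | [x, y] => x < y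
  | x :: y :: z :: l => (x < y ∨ y < z) ∧ Tame (y :: z :: l)

/-- The number of descents of a word. -/
def descents : List α → ℕ
  | x :: y :: l => (if y < x then 1 else 0) + descents (y :: l)
  | _ => 0

theorem Tame.tail {x y : α} {l : List α} (h : Tame (x :: y :: l)) : Tame (y :: l) := by
  cases l with
  | nil => trivial
  | cons z l => exact h.2

theorem tame_cons_of_lt {x y : α} {l : List α} (h : x < y) :
    Tame (x :: y :: l) ↔ Tame (y :: l) := by
  cases l with
  | nil => exact iff_of_true h trivial
  | cons z l => exact and_iff_right (Or.inl h)

theorem tame_cons_of_gt {x y z : α} {l : List α} (h : y < x) :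
    Tame (x :: y :: z :: l) ↔ y < z ∧ Tame (y :: z :: l) :=
  and_congr_left' (or_iff_right h.not_gt)

theorem descents_cons_of_lt {x y : α} {l : List α} (h : x < y) :
    descents (x :: y :: l) = descents (y :: l) := by
  rw [descents, if_neg h.not_gt, zero_add]

theorem descents_cons_of_gt {x y : α} {l : List α} (h : y < x) :
    descents (x :: y :: l) = descents (y :: l) + 1 := by
  rw [descents, if_pos h, add_comm]

theorem Tame.two_mul_descents_add_lt {x y : α} {l : List α} (h : Tame (x :: y :: l)) :
    2 * descents (x :: y :: l) + 1 ≤ (x :: y :: l).length ∧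
      (x < y → 2 * descents (x :: y :: l) + 2 ≤ (x :: y :: l).length) := by
  induction l generalizing x y with
  | nil =>
    have h' : x < y := h
    rw [descents_cons_of_lt h']
    simp [descents]
  | cons z l ih =>
    have h' := ih h.2
    simp only [List.length_cons] at h' ⊢
    rcases lt_or_ge y x with hxy | hxy
    · have hyz := ((tame_cons_of_gt hxy).1 h).1
      rw [descents_cons_of_gt hxy]
      have := h'.2 hyz
      exact ⟨by omega, fun h => absurd h hxy.not_gt⟩
    · rw [descents, if_neg hxy.not_gt]
      omega

theorem Tame.two_mul_descents_lt_length {l : List α} (h : Tame l) :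
    2 * descents l + 1 ≤ l.length := by
  match l, h with
  | [_], _ => simp [descents]
  | _ :: _ :: _, h => exact h.two_mul_descents_add_lt.1

open Classical in
/-- Contribution to a sum over tame words of the word `l`, weighted by its descents. -/
noncomputable def tameWeight (φ : ℕ → ℕ) (l : List α) : ℕ :=
  if Tame l then φ (descents l) else 0

theorem tameWeight_congr {φ ψ : ℕ → ℕ} {l l' : List α} (h : Tame l ↔ Tame l')
    (h' : Tame l' → φ (descents l) = ψ (descents l')) : tameWeight φ l = tameWeight ψ l' := by
  unfold tameWeight
  split_ifs with h₁ h₂ h₂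
  · exact h' h₂
  · exact absurd (h.1 h₁) h₂
  · exact absurd (h.2 h₂) h₁
  · rfl

/-- Inserting a new maximum into a tame word, elsewhere than at the end. -/
theorem sum_tameWeight_insertIdx (φ : ℕ → ℕ) (M : α) (l : List α) (hl : Tame l)
    (hnd : l.Nodup) (hM : ∀ x ∈ l, x < M) :
    ∑ i ∈ Finset.range l.length, tameWeight φ (l.insertIdx i M) =
      descents l * φ (descents l) + (l.length - 1 - 2 * descents l) * φ (descents l + 1) := by
  induction l generalizing φ with
  | nil => exact hl.elim
  | cons x l ih =>
    have hx : x < M := hM x List.mem_cons_self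
    cases l with
    | nil =>
      have : ¬ Tame [M, x] := hx.not_gt
      simp [descents, tameWeight, this]
    | cons y l =>
      have hy : y < M := hM y (by simp)
      have hih (ψ) := ih ψ hl.tail hnd.of_cons fun z hz => hM z (List.mem_cons_of_mem _ hz)
      have hlen := hl.two_mul_descents_add_lt
      have hlen' := hl.tail.two_mul_descents_lt_length
      simp only [List.length_cons] at hih hlen hlen' ⊢
      rw [Finset.sum_range_succ']
      simp only [List.insertIdx_zero, List.insertIdx_succ_cons]
      rcases lt_or_ge x y with hxy | hyx
      · have h₀ : tameWeight φ (M :: x :: y :: l) = φ (descents (y :: l) + 1) := by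
          rw [tameWeight, if_pos ((tame_cons_of_gt hx).2 ⟨hxy, hl⟩), descents_cons_of_gt hx,
            descents_cons_of_lt hxy]
        have h₁ : ∀ i ∈ Finset.range (l.length + 1),
            tameWeight φ (x :: (y :: l).insertIdx i M) =
              tameWeight φ ((y :: l).insertIdx i M) := by
          rintro (_ | i) -
          · exact tameWeight_congr (tame_cons_of_lt hx) fun _ => by
              rw [List.insertIdx_zero, descents_cons_of_lt hx]
          · exact tameWeight_congr (tame_cons_of_lt hxy) fun _ => by
              rw [List.insertIdx_succ_cons, descents_cons_of_lt hxy]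
        rw [Finset.sum_congr rfl h₁, hih, h₀, descents_cons_of_lt hxy]
        have := hlen.2 hxy
        rw [descents_cons_of_lt hxy] at this
        rw [show l.length + 1 + 1 - 1 - 2 * descents (y :: l) =
          (l.length + 1 - 1 - 2 * descents (y :: l)) + 1 by omega]
        ring
      · have hyx : y < x := lt_of_le_of_ne hyx fun h => by simp [h] at hnd
        cases l with
        | nil => exact absurd hl hyx.not_gt
        | cons z l =>
          have hyz := ((tame_cons_of_gt hyx).1 hl).1
          have h₀ : tameWeight φ (M :: x :: y :: z :: l) = 0 :=
            if_neg fun h => ((tame_cons_of_gt hx).1 h).1.not_gt hyx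
          have hMy : Tame (M :: y :: z :: l) := (tame_cons_of_gt hy).2 ⟨hyz, hl.tail⟩
          have h₁ : tameWeight φ (x :: M :: y :: z :: l) = φ (descents (y :: z :: l) + 1) := by
            rw [tameWeight, if_pos ((tame_cons_of_lt hx).2 hMy), descents_cons_of_lt hx,
              descents_cons_of_gt hy]
          have h₂ : tameWeight (fun d => φ (d + 1)) (M :: y :: z :: l) =
              φ (descents (y :: z :: l) + 2) := by
            rw [tameWeight, if_pos hMy, descents_cons_of_gt hy]
          have h₃ : ∀ i ∈ Finset.range (z :: l).length,
              tameWeight φ (x :: y :: (z :: l).insertIdx i M) =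
                tameWeight (fun d => φ (d + 1)) (y :: (z :: l).insertIdx i M) := by
            intro i _
            refine tameWeight_congr ?_ fun _ => by rw [descents_cons_of_gt hyx]
            cases i with
            | zero => exact (tame_cons_of_gt hyx).trans (and_iff_right hy)
            | succ i => exact (tame_cons_of_gt hyx).trans (and_iff_right hyz)
          have h₄ := hih fun d => φ (d + 1)
          have h₅ := hlen.1
          have h₆ := hl.tail.two_mul_descents_add_lt.2 hyz
          rw [Finset.sum_range_succ'] at h₄ ⊢
          simp only [List.insertIdx_zero, List.insertIdx_succ_cons, List.length_cons] at h₃ h₄ h₆ ⊢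
          rw [h₂] at h₄
          rw [Finset.sum_congr rfl h₃, h₀, h₁, descents_cons_of_gt hyx]
          generalize descents (y :: z :: l) = d at *
          obtain ⟨a, ha⟩ := Nat.exists_eq_add_of_le h₆
          rw [show l.length + 1 + 1 - 1 - 2 * d = a + 1 by omega] at h₄
          rw [show l.length + 1 + 1 + 1 - 1 - 2 * (d + 1) = a by omega]
          linear_combination h₄

theorem tame_concat {M : α} {l : List α} (hl : Tame l) (hM : ∀ x ∈ l, x < M) :
    Tame (l ++ [M]) ∧ descents (l ++ [M]) = descents l := by
  induction l with
  | nil => exact hl.elim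
  | cons x l ih =>
    cases l with
    | nil =>
      have hx : x < M := hM x List.mem_cons_self
      exact ⟨hx, descents_cons_of_lt hx⟩
    | cons y l =>
      have h := ih hl.tail fun z hz => hM z (List.mem_cons_of_mem _ hz)
      simp only [List.cons_append] at h ⊢
      refine ⟨?_, by rw [descents, descents, h.2]⟩
      cases l with
      | nil => exact ⟨Or.inl hl, h.1⟩
      | cons z l => exact ⟨hl.1, h.1⟩

/-- André words: for each letter `x`, the subword of letters at most `x` has no double descents
and ends with an ascent. -/
def AndreWord (l : List α) : Prop :=
  ∀ x ∈ l, Tame (l.filter (· ≤ x))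

theorem AndreWord.tame {l : List α} (h : AndreWord l) (hl : l ≠ []) : Tame l := by
  obtain ⟨x, hx, hmax⟩ := l.toFinset.exists_max_image id (by simpa using hl)
  have h' := h x (List.mem_toFinset.1 hx)
  rwa [List.filter_eq_self.2 fun y hy => by simpa using hmax y (List.mem_toFinset.2 hy)] at h'

theorem filter_insertIdx_of_neg {β : Type*} {p : β → Bool} {M : β} (hM : ¬ p M) (l : List β)
    (i : ℕ) :
    (l.insertIdx i M).filter p = l.filter p := by
  induction l generalizing i with
  | nil => cases i <;> simp [hM]
  | cons x l ih => cases i <;> simp [hM, List.filter_cons, ih]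

theorem andreWord_insertIdx_iff {M : α} {l : List α} (hM : ∀ x ∈ l, x < M) {i : ℕ}
    (hi : i ≤ l.length) :
    AndreWord (l.insertIdx i M) ↔ AndreWord l ∧ Tame (l.insertIdx i M) := by
  have h₁ : (l.insertIdx i M).filter (· ≤ M) = l.insertIdx i M := by
    refine List.filter_eq_self.2 fun y hy => ?_
    rcases (List.mem_insertIdx hi).1 hy with rfl | hy
    · simp
    · simpa using (hM y hy).le
  have h₂ : ∀ x ∈ l, (l.insertIdx i M).filter (· ≤ x) = l.filter (· ≤ x) := fun x hx =>
    filter_insertIdx_of_neg (by simpa using hM x hx) l i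
  constructor
  · intro h
    refine ⟨fun x hx => ?_, ?_⟩
    · rw [← h₂ x hx]
      exact h x ((List.mem_insertIdx hi).2 (Or.inr hx))
    · rw [← h₁]
      exact h M ((List.mem_insertIdx hi).2 (Or.inl rfl))
  · rintro ⟨h, h'⟩ x hx
    rcases (List.mem_insertIdx hi).1 hx with rfl | hx
    · rwa [h₁]
    · rw [h₂ x hx]
      exact h x hx

theorem getLast?_insertIdx {β : Type*} {M : β} {l : List β} {i : ℕ} (hi : i < l.length) :
    (l.insertIdx i M).getLast? = l.getLast? := by
  rw [List.getLast?_eq_getElem?, List.getLast?_eq_getElem?,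
    List.length_insertIdx_of_le_length hi.le, List.getElem?_insertIdx_of_gt (by omega)]
  rfl

theorem erase_insertIdx {M : α} {l : List α} (hM : M ∉ l) {i : ℕ} (hi : i ≤ l.length) :
    (l.insertIdx i M).erase M = l := by
  induction l generalizing i with
  | nil => obtain rfl : i = 0 := by simpa using hi
           simp
  | cons x l ih =>
    rw [List.mem_cons, not_or] at hM
    cases i with
    | zero => simp
    | succ i =>
      rw [List.insertIdx_succ_cons, List.erase_cons_tail (by simpa using Ne.symm hM.1),
        ih hM.2 (by simpa using hi)]

theorem idxOf_insertIdx {M : α} {l : List α} (hM : M ∉ l) {i : ℕ} (hi : i ≤ l.length) :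
    (l.insertIdx i M).idxOf M = i := by
  induction l generalizing i with
  | nil => obtain rfl : i = 0 := by simpa using hi
           simp
  | cons x l ih =>
    rw [List.mem_cons, not_or] at hM
    cases i with
    | zero => simp
    | succ i =>
      rw [List.insertIdx_succ_cons, List.idxOf_cons_ne _ (Ne.symm hM.1),
        ih hM.2 (by simpa using hi)]

theorem insertIdx_idxOf_erase {M : α} {l : List α} (hM : M ∈ l) :
    (l.erase M).insertIdx (l.idxOf M) M = l := by
  induction l with
  | nil => simp at hM
  | cons x l ih =>
    by_cases hx : x = M
    · subst hx
      simp
    · rw [List.idxOf_cons_ne _ hx, List.erase_cons_tail (by simpa using hx),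
        List.insertIdx_succ_cons, ih (List.mem_of_ne_of_mem (Ne.symm hx) hM)]

theorem mem_arrangements_iff_coe {S : Finset α} {l : List α} :
    l ∈ arrangements S ↔ S.val = (l : Multiset α) := by
  rw [arrangements, Multiset.mem_toFinset, Multiset.mem_lists_iff]
  rfl

theorem mem_of_mem_arrangements {S : Finset α} {l : List α} (h : l ∈ arrangements S) {x : α} :
    x ∈ l ↔ x ∈ S := by
  rw [← (mem_arrangements.1 h).2, List.mem_toFinset]

theorem sum_arrangements_insert {S : Finset α} {M : α} (hM : M ∉ S) (g : List α → ℕ) :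
    ∑ l ∈ arrangements (insert M S), g l =
      ∑ l ∈ arrangements S, ∑ i ∈ Finset.range (S.card + 1), g (l.insertIdx i M) := by
  rw [← Finset.sum_product']
  symm
  refine Finset.sum_nbij' (fun x => x.1.insertIdx x.2 M) (fun l => (l.erase M, l.idxOf M))
    ?_ ?_ ?_ ?_ fun _ _ => rfl
  · rintro ⟨l, i⟩ h
    obtain ⟨hl, hi⟩ := Finset.mem_product.1 h
    have hi : i ≤ l.length := by
      rw [length_of_mem_arrangements hl]
      exact Nat.lt_succ_iff.1 (Finset.mem_range.1 hi)
    rw [mem_arrangements_iff_coe] at hl ⊢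
    rw [Finset.insert_val_of_notMem hM, hl, Multiset.cons_coe, Multiset.coe_eq_coe]
    exact (List.perm_insertIdx M l hi).symm
  · intro l hl
    have hMl : M ∈ l := (mem_of_mem_arrangements hl).2 (Finset.mem_insert_self _ _)
    refine Finset.mem_product.2 ⟨?_, Finset.mem_range.2 ?_⟩
    · rw [mem_arrangements_iff_coe] at hl ⊢
      rw [← Multiset.coe_erase, ← hl, Finset.insert_val_of_notMem hM, Multiset.erase_cons_head]
    · rw [← Finset.card_insert_of_notMem hM, ← length_of_mem_arrangements hl]
      exact List.idxOf_lt_length_iff.2 hMl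
  · rintro ⟨l, i⟩ h
    obtain ⟨hl, hi⟩ := Finset.mem_product.1 h
    have hi : i ≤ l.length := by
      rw [length_of_mem_arrangements hl]
      exact Nat.lt_succ_iff.1 (Finset.mem_range.1 hi)
    have hMl : M ∉ l := fun h => hM ((mem_of_mem_arrangements hl).1 h)
    exact Prod.ext (erase_insertIdx hMl hi) (idxOf_insertIdx hMl hi)
  · intro l hl
    exact insertIdx_idxOf_erase
      ((mem_of_mem_arrangements hl).2 (Finset.mem_insert_self _ _))

open Classical in
/-- The André words using each letter of `S` exactly once. -/
noncomputable def andreWords (S : Finset α) : Finset (List α) :=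
  (arrangements S).filter AndreWord

theorem mem_andreWords {S : Finset α} {l : List α} :
    l ∈ andreWords S ↔ l ∈ arrangements S ∧ AndreWord l := by
  classical rw [andreWords, Finset.mem_filter]

theorem andreWords_empty : andreWords (∅ : Finset α) = {[]} := by
  ext l
  rw [mem_andreWords, arrangements_empty, Finset.mem_singleton, and_iff_left_iff_imp]
  rintro rfl x hx
  simp at hx

theorem two_mul_descents_lt_card {S : Finset α} (hS : S.Nonempty) {l : List α}
    (hl : l ∈ andreWords S) : 2 * descents l + 1 ≤ S.card := by
  rw [mem_andreWords] at hl
  have h := length_of_mem_arrangements hl.1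
  rw [← h]
  refine (hl.2.tame ?_).two_mul_descents_lt_length
  rintro rfl
  exact hS.card_ne_zero h.symm

/-- Every André word arises from a smaller one by inserting the maximal letter. -/
theorem sum_andreWords_insert {S : Finset α} {M : α} (hM : ∀ x ∈ S, x < M)
    (g : Option α → ℕ → ℕ) :
    ∑ l ∈ andreWords (insert M S), g l.getLast? (descents l) =
      ∑ l ∈ andreWords S, (g (some M) (descents l) + (descents l * g l.getLast? (descents l) +
        (S.card - 1 - 2 * descents l) * g l.getLast? (descents l + 1))) := by
  classical
  rw [andreWords, andreWords, Finset.sum_filter, Finset.sum_filter,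
    sum_arrangements_insert fun h => (hM M h).false]
  refine Finset.sum_congr rfl fun l hl => ?_
  have hlen := length_of_mem_arrangements hl
  have hlM : ∀ x ∈ l, x < M := fun x hx => hM x ((mem_of_mem_arrangements hl).1 hx)
  split_ifs with hA
  · have hmain : ∀ i ∈ Finset.range l.length,
        (if AndreWord (l.insertIdx i M) then
          g (l.insertIdx i M).getLast? (descents (l.insertIdx i M)) else 0) =
        tameWeight (g l.getLast?) (l.insertIdx i M) := by
      intro i hi
      have hi := Finset.mem_range.1 hi
      simp only [andreWord_insertIdx_iff hlM hi.le, hA, true_and, getLast?_insertIdx hi,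
        tameWeight]
    rw [← hlen, Finset.sum_range_succ, Finset.sum_congr rfl hmain, add_comm]
    by_cases hnil : l = []
    · subst hnil
      have : AndreWord [M] := fun _ _ => by simp_all [Tame]
      simp [this, descents]
    · have hT := hA.tame hnil
      have hc := tame_concat hT hlM
      rw [sum_tameWeight_insertIdx _ _ _ hT (mem_arrangements.1 hl).1 hlM,
        if_pos ((andreWord_insertIdx_iff hlM le_rfl).2
          ⟨hA, by rw [List.insertIdx_length_self]; exact hc.1⟩),
        List.insertIdx_length_self, hc.2, List.getLast?_concat]
  · refine Finset.sum_eq_zero fun i hi => if_neg fun h => hA ?_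
    rw [← hlen, Finset.mem_range, Nat.lt_succ_iff] at hi
    exact ((andreWord_insertIdx_iff hlM hi).1 h).1

theorem exists_eq_insert_of_max {S : Finset α} (hS : S.Nonempty) :
    ∃ M ∈ S, ∀ x ∈ S.erase M, x < M :=
  ⟨S.max' hS, S.max'_mem hS, fun _ hx => S.lt_max'_of_mem_erase_max' hS hx⟩

theorem sum_andreWords (m : ℕ) (S : Finset α) (hS : S.card = m + 1) (φ : ℕ → ℕ → ℕ) :
    ∑ l ∈ andreWords S, φ (m - 2 * descents l) (descents l) = insertSum^[m] φ 0 0 := by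
  induction m generalizing S φ with
  | zero =>
    obtain ⟨M, rfl⟩ := Finset.card_eq_one.1 hS
    have h := sum_andreWords_insert (S := ∅) (M := M) (by simp) fun _ d => φ (0 - 2 * d) d
    rw [← insert_empty_eq, h, andreWords_empty, Finset.sum_singleton]
    simp [descents]
  | succ m ih =>
    obtain ⟨M, hMS, hM⟩ := exists_eq_insert_of_max (S := S) (Finset.card_pos.1 (by omega))
    have hcard : (S.erase M).card = m + 1 := by rw [Finset.card_erase_of_mem hMS, hS]; rfl
    have h := sum_andreWords_insert hM fun _ d => φ (m + 1 - 2 * d) d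
    rw [Finset.insert_erase hMS] at h
    rw [h, Function.iterate_succ_apply, ← ih _ hcard]
    refine Finset.sum_congr rfl fun l hl => ?_
    have hd := two_mul_descents_lt_card (Finset.card_pos.1 (by omega)) hl
    rw [hcard] at hd ⊢
    rw [insertSum, show m + 1 - 1 - 2 * descents l = m - 2 * descents l from rfl,
      show m + 1 - 2 * descents l = m - 2 * descents l + 1 by omega,
      show m + 1 - 2 * (descents l + 1) = m - 2 * descents l - 1 by omega]
    ring

theorem sum_andreWords_getLast (r q : ℕ) (S : Finset α) (k : α) (hk : k ∈ S)
    (hq : (S.filter (k < ·)).card = q) :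
    (∑ l ∈ andreWords S, if l.getLast? = some k then
        completions r (S.card - 1 - 2 * descents l) (descents l) else 0) =
      andreNumber (S.filter (· < k)).card (q + r) := by
  induction q generalizing r S with
  | zero =>
    have hmax : ∀ x ∈ S.erase k, x < k := by
      intro x hx
      obtain ⟨hxk, hx⟩ := Finset.mem_erase.1 hx
      refine lt_of_le_of_ne (not_lt.1 fun h => ?_) hxk
      exact Finset.filter_eq_empty_iff.1 (Finset.card_eq_zero.1 hq) hx h
    have h := sum_andreWords_insert hmax fun o d =>
      if o = some k then completions r (S.card - 1 - 2 * d) d else 0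
    have hfilter : S.filter (· < k) = S.erase k := by
      ext x
      rw [Finset.mem_filter, Finset.mem_erase]
      exact ⟨fun h => ⟨h.2.ne, h.1⟩, fun h => ⟨h.2, hmax x (Finset.mem_erase.2 h)⟩⟩
    have hlast : ∀ l ∈ andreWords (S.erase k), l.getLast? ≠ some k := fun l hl h =>
      Finset.notMem_erase k S
        ((mem_of_mem_arrangements (mem_andreWords.1 hl).1).1 (List.mem_of_getLast? h))
    rw [Finset.insert_erase hk] at h
    rw [h, hfilter, zero_add]
    have hcard := Finset.card_erase_add_one hk
    rcases hm : (S.erase k).card with _ | m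
    · rw [Finset.card_eq_zero] at hm
      have h₁ : S.card = 1 := by rw [← hcard, hm]; rfl
      simp [hm, andreWords_empty, descents, andreNumber, h₁]
    · rw [andreNumber, ← sum_andreWords m _ hm]
      refine Finset.sum_congr rfl fun l hl => ?_
      have hd := two_mul_descents_lt_card (Finset.card_pos.1 (by omega)) hl
      rw [if_pos rfl, if_neg (hlast l hl), if_neg (hlast l hl), mul_zero, mul_zero, add_zero,
        add_zero, ← hcard, hm,
        show m + 1 + 1 - 1 - 2 * descents l = m - 2 * descents l + 1 by omega]
  | succ q ih =>
    obtain ⟨M, hMS, hM⟩ := exists_eq_insert_of_max ⟨k, hk⟩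
    obtain ⟨y, hy⟩ : (S.filter (k < ·)).Nonempty := Finset.card_pos.1 (by omega)
    rw [Finset.mem_filter] at hy
    have hkM : k < M := by
      rcases eq_or_ne y M with rfl | hyM
      · exact hy.2
      · exact hy.2.trans (hM y (Finset.mem_erase.2 ⟨hyM, hy.1⟩))
    have hk' : k ∈ S.erase M := Finset.mem_erase.2 ⟨hkM.ne, hk⟩
    have hcard := Finset.card_erase_add_one hMS
    have hq' : ((S.erase M).filter (k < ·)).card = q := by
      rw [Finset.filter_erase, Finset.card_erase_of_mem (Finset.mem_filter.2 ⟨hMS, hkM⟩), hq]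
      rfl
    have hp : (S.erase M).filter (· < k) = S.filter (· < k) := by
      rw [Finset.filter_erase, Finset.erase_eq_of_notMem]
      exact fun h => (Finset.mem_filter.1 h).2.not_gt hkM
    have h := sum_andreWords_insert hM fun o d =>
      if o = some k then completions r (S.card - 1 - 2 * d) d else 0
    rw [Finset.insert_erase hMS] at h
    rw [h, Nat.add_right_comm q 1 r, Nat.add_assoc q r 1, ← hp, ← ih (r + 1) _ hk' hq']
    refine Finset.sum_congr rfl fun l hl => ?_
    have hd := two_mul_descents_lt_card ⟨k, hk'⟩ hl
    rw [if_neg (by simpa using hkM.ne'), zero_add]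
    split_ifs with hlast
    · rw [completions, ← hcard]
      generalize (S.erase M).card = c at *
      rw [show c + 1 - 1 - 2 * descents l = c - 1 - 2 * descents l + 1 by omega,
        show c + 1 - 1 - 2 * (descents l + 1) = c - 1 - 2 * descents l - 1 by omega]
    · simp

open Classical in
/-- André words are counted by the Entringer numbers. -/
theorem card_andreWord (S : Finset α) (k : α) (hk : k ∈ S) :
    ((arrangements S).filter fun l => AndreWord l ∧ l.getLast? = some k).card =
      entringer (S.filter (· < k)).card (S.filter (k < ·)).card := by
  have h := sum_andreWords_getLast 0 _ S k hk rfl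
  simp only [completions, add_zero] at h
  rw [← andreNumber_eq_entringer, ← h, ← Finset.card_filter, andreWords, Finset.filter_filter]

theorem tame_iff {l : List α} (hl : l.Nodup) :
    Tame l ↔ ¬ HasDoubleDescent l ∧ EndsWithAscent l := by
  induction l with
  | nil => simp [Tame, EndsWithAscent]
  | cons x l ih =>
    match l, ih, hl with
    | [], _, _ =>
      refine iff_of_true trivial ⟨?_, Or.inl rfl⟩
      rintro ⟨i, h, -⟩
      simp at h
    | [y], _, _ =>
      constructor
      · intro h
        refine ⟨?_, Or.inr ⟨by simp, h⟩⟩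
        rintro ⟨i, h, -⟩
        simp at h
      · rintro ⟨_, h | ⟨_, h⟩⟩
        · simp at h
        · exact h
    | y :: z :: l, ih, hl =>
      have hxy : x ≠ y := fun h => by simp [h] at hl
      have hyz : y ≠ z := fun h => by simp [h] at hl
      have hD : HasDoubleDescent (x :: y :: z :: l) ↔
          (y < x ∧ z < y) ∨ HasDoubleDescent (y :: z :: l) := by
        constructor
        · rintro ⟨_ | i, h, h'⟩
          · exact Or.inl h'
          · exact Or.inr ⟨i, by simpa using h, h'⟩
        · rintro (h | ⟨i, h, h'⟩)
          · exact ⟨0, by simp, h⟩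
          · exact ⟨i + 1, by simpa using h, h'⟩
      have hE : EndsWithAscent (x :: y :: z :: l) ↔ EndsWithAscent (y :: z :: l) := by
        simp [EndsWithAscent]
      rw [Tame, ih hl.of_cons, hD, hE, not_or, not_and_or, not_lt, not_lt, hxy.le_iff_lt,
        hyz.le_iff_lt, and_assoc]

end Words

theorem IsSignedPerm.nodup {n : ℕ} {l : List ℤ} (h : IsSignedPerm n l) : l.Nodup :=
  List.Nodup.of_map _ (h.nodup_iff.2 List.nodup_range')

theorem IsSignedPerm.length_eq {n : ℕ} {l : List ℤ} (h : IsSignedPerm n l) : l.length = n := by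
  simpa using List.Perm.length_eq h

theorem countP_le_lt_countP_le {l : List ℤ} {x y : ℤ} (hy : y ∈ l) (hxy : x < y) :
    l.countP (fun z => decide (z ≤ x)) < l.countP (fun z => decide (z ≤ y)) := by
  have hy' : y ∉ l.filter (fun z => decide (z ≤ x)) := by simp [hxy]
  have hsub : (l.filter (fun z => decide (z ≤ x))).Sublist (l.filter (fun z => decide (z ≤ y))) :=
    List.monotone_filter_right l fun z hz => by
      simp only [decide_eq_true_eq] at hz ⊢
      exact hz.trans hxy.le
  rw [List.countP_eq_length_filter, List.countP_eq_length_filter]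
  refine lt_of_le_of_ne hsub.length_le fun h => hy' ?_
  rw [hsub.eq_of_length h]
  simp [hy]

theorem countP_le_le_countP_le_iff {l : List ℤ} {x y : ℤ} (hx : x ∈ l) :
    l.countP (fun z => decide (z ≤ x)) ≤ l.countP (fun z => decide (z ≤ y)) ↔ x ≤ y := by
  refine ⟨fun h => not_lt.1 fun hyx => (countP_le_lt_countP_le hx hyx).not_ge h, fun h => ?_⟩
  exact List.countP_mono_left fun z _ hz => by
    simp only [decide_eq_true_eq] at hz ⊢
    exact hz.trans h

theorem lowerSubword_countP (l : List ℤ) (x : ℤ) :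
    lowerSubword l (l.countP fun z => decide (z ≤ x)) = l.filter (· ≤ x) :=
  List.filter_congr fun y hy => by simp only [countP_le_le_countP_le_iff hy]

theorem exists_countP_eq {l : List ℤ} (hl : l.Nodup) {k : ℕ} (h₁ : 1 ≤ k) (h₂ : k ≤ l.length) :
    ∃ x ∈ l, l.countP (fun z => decide (z ≤ x)) = k := by
  obtain ⟨x, hx, h⟩ := Finset.surj_on_of_inj_on_of_card_le (s := l.toFinset)
    (t := Finset.Icc 1 l.length) (fun x _ => l.countP fun z => decide (z ≤ x))
    (fun x hx => Finset.mem_Icc.2 ⟨List.countP_pos_iff.2 ⟨x, List.mem_toFinset.1 hx, by simp⟩,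
      List.countP_le_length⟩)
    (fun x y hx hy h => le_antisymm
      ((countP_le_le_countP_le_iff (List.mem_toFinset.1 hx)).1 h.le)
      ((countP_le_le_countP_le_iff (List.mem_toFinset.1 hy)).1 h.ge))
    (by rw [List.toFinset_card_of_nodup hl]; simp) k (Finset.mem_Icc.2 ⟨h₁, h₂⟩)
  exact ⟨x, List.mem_toFinset.1 hx, h.symm⟩

theorem isSignedAndre_iff {n : ℕ} {l : List ℤ} :
    IsSignedAndre n l ↔ IsSignedPerm n l ∧ AndreWord l := by
  refine and_congr_right fun hl => ⟨fun h x hx => ?_, fun h k h₁ h₂ => ?_⟩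
  · rw [tame_iff (hl.nodup.filter _), ← lowerSubword_countP]
    refine h _ (List.countP_pos_iff.2 ⟨x, hx, by simp⟩) ?_
    rw [← hl.length_eq]
    exact List.countP_le_length
  · obtain ⟨x, hx, rfl⟩ := exists_countP_eq hl.nodup h₁ (h₂.trans_eq hl.length_eq.symm)
    rw [lowerSubword_countP, ← tame_iff (hl.nodup.filter _)]
    exact h x hx

/-- The sets of letters of the signed permutations of `[n]`. -/
noncomputable def signedSupports (n : ℕ) : Finset (Finset ℤ) :=
  (Finset.Icc (-n : ℤ) n).powerset.filter fun S =>
    S.val.map Int.natAbs = (List.range' 1 n : Multiset ℕ)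

theorem isSignedPerm_iff {n : ℕ} {l : List ℤ} :
    IsSignedPerm n l ↔ ∃ S ∈ signedSupports n, l ∈ arrangements S := by
  simp only [signedSupports, Finset.mem_filter, mem_arrangements_iff_coe]
  constructor
  · intro h
    refine ⟨⟨l, h.nodup⟩, ⟨?_, Multiset.coe_eq_coe.2 h⟩, rfl⟩
    refine Finset.mem_powerset.2 fun x hx => Finset.mem_Icc.2 ?_
    have hx' := h.mem_iff.1 (List.mem_map_of_mem (f := Int.natAbs) (show x ∈ l from hx))
    rw [List.mem_range'_1] at hx'
    omega
  · rintro ⟨S, ⟨-, h⟩, hS⟩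
    rw [hS] at h
    exact Multiset.coe_eq_coe.1 h

theorem card_isSignedPerm_and (n : ℕ) (Q : List ℤ → Prop) [DecidablePred Q] :
    Nat.card {l : List ℤ // IsSignedPerm n l ∧ Q l} =
      ∑ S ∈ signedSupports n, ((arrangements S).filter Q).card := by
  rw [← Finset.card_biUnion]
  · refine Nat.subtype_card _ fun l => ?_
    simp only [Finset.mem_biUnion, Finset.mem_filter, isSignedPerm_iff]
    tauto
  · intro S _ T _ hST
    refine Finset.disjoint_left.2 fun l hS hT => hST ?_
    rw [← (mem_arrangements.1 (Finset.mem_filter.1 hS).1).2,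
      (mem_arrangements.1 (Finset.mem_filter.1 hT).1).2]

/-- For `1 ≤ |k| ≤ n`, the number of signed André permutations of `[n]` with last
entry `k` equals the number of down-up alternating permutations of type `B_n`
with first entry `k`. -/
theorem card_signedAndre_last_eq_card_downUpB_first
    (n : ℕ) (k : ℤ) (hn : 1 ≤ n) (hk : 1 ≤ |k|) (hkn : |k| ≤ (n : ℤ)) :
    Nat.card {l : List ℤ // IsSignedAndre n l ∧ l.getLast? = some k}
      = Nat.card {l : List ℤ // IsSignedPerm n l ∧ DownUpWord l ∧ l.head? = some k} := by
  classical
  simp only [isSignedAndre_iff, and_assoc, downUpWord_iff_alternating]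
  rw [card_isSignedPerm_and, card_isSignedPerm_and]
  refine Finset.sum_congr rfl fun S _ => ?_
  by_cases hkS : k ∈ S
  · have hA := card_andreWord S k hkS
    have hD := card_alternating true S k hkS
    have h₁ : S.filter (Step true k) = S.filter (· < k) :=
      Finset.filter_congr fun x _ => by simp [Step]
    have h₂ : S.filter (Step (!true) k) = S.filter (k < ·) :=
      Finset.filter_congr fun x _ => by simp [Step]
    rw [h₁, h₂] at hD
    convert hA.trans hD.symm
  · rw [Finset.filter_false_of_mem, Finset.filter_false_of_mem]
    · exact fun l hl h => hkS ((mem_of_mem_arrangements hl).1 (List.mem_of_head? h.2))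
    · exact fun l hl h => hkS ((mem_of_mem_arrangements hl).1 (List.mem_of_getLast? h.2))
end

section
/- For all integers n ≥ 1 and all integers k with 1 ≤ |k| ≤ n, the number of signed André permutations of [n] whose last entry is k equals the Arnold number S_{n,k}; that is, #DA^B_{n,k} = S_{n,k}. -/
namespace SignedAndre

open Finset

/-- The Euler zigzag numbers, through the recurrence that removes the smallest letter. -/
def zigzag : ℕ → ℕ
  | 0 => 1
  | 1 => 1
  | n + 2 => ∑ i : Fin (n + 1), n.choose i * zigzag i * zigzag (n - i + 1)

/-- The number of André words with `p` letters below the last letter and `q` letters above it. -/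
def entringer : ℕ → ℕ → ℕ
  | 0, 0 => 1
  | 0, _ + 1 => 0
  | 1, q => zigzag q
  | p + 2, q => ∑ i : Fin (p + 1), ∑ j : Fin (q + 1),
      p.choose i * q.choose j * zigzag (i + j) * entringer (p - i + 1) (q - j)

/-- Coefficients of the product of the exponential generating functions `e (x + y)` and
`f (x, y)`. -/
def binomConv {R : Type*} [CommSemiring R] (e : ℕ → R) (f : ℕ → ℕ → R) (p q : ℕ) : R :=
  ∑ x ∈ antidiagonal p, (p.choose x.1 : R) *
    ∑ y ∈ antidiagonal q, (q.choose y.1 : R) * (e (x.1 + y.1) * f x.2 y.2)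

section BinomConv

variable {R : Type*} [CommSemiring R] (e : ℕ → R) (f g : ℕ → ℕ → R) (p q : ℕ)

theorem binomConv_swap :
    binomConv e f q p = binomConv e (fun i j => f j i) p q := by
  simp only [binomConv, mul_sum]
  rw [sum_comm]
  refine sum_congr rfl fun x _ => sum_congr rfl fun y _ => ?_
  rw [add_comm y.1]
  ring

theorem binomConv_succ_left :
    binomConv e f (p + 1) q =
      binomConv e (fun i j => f (i + 1) j) p q + binomConv (fun n => e (n + 1)) f p q := by
  unfold binomConv
  rw [Finset.sum_antidiagonal_choose_succ_mul
    (fun a b => ∑ y ∈ antidiagonal q, (q.choose y.1 : R) * (e (a + y.1) * f b y.2))]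
  congr 1
  refine sum_congr rfl fun x hx => ?_
  rw [← Nat.choose_symm_of_eq_add (mem_antidiagonal.1 hx).symm]
  simp only [add_right_comm]

theorem binomConv_succ_right :
    binomConv e f p (q + 1) =
      binomConv e (fun i j => f i (j + 1)) p q + binomConv (fun n => e (n + 1)) f p q := by
  rw [binomConv_swap, binomConv_succ_left, binomConv_swap _ _ p q, binomConv_swap _ _ p q]

theorem binomConv_add :
    binomConv e (fun i j => f i j + g i j) p q = binomConv e f p q + binomConv e g p q := by
  simp only [binomConv, mul_add, sum_add_distrib]

variable {f g p q} in
theorem binomConv_congr (h : ∀ i j, i ≤ p → j ≤ q → f i j = g i j) :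
    binomConv e f p q = binomConv e g p q := by
  refine sum_congr rfl fun x hx => ?_
  congr 1
  refine sum_congr rfl fun y hy => ?_
  rw [h _ _ (by have := mem_antidiagonal.1 hx; omega)
    (by have := mem_antidiagonal.1 hy; omega)]

end BinomConv

theorem entringer_zero_succ (q : ℕ) : entringer 0 (q + 1) = 0 := by simp [entringer]

theorem entringer_one (q : ℕ) : entringer 1 q = zigzag q := by simp [entringer]

theorem entringer_add_two (p q : ℕ) :
    entringer (p + 2) q = binomConv zigzag (fun i j => entringer (i + 1) j) p q := by
  rw [entringer, binomConv]
  simp only [Nat.cast_id]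
  rw [Nat.sum_antidiagonal_eq_sum_range_succ
    (fun a b => p.choose a * ∑ y ∈ antidiagonal q,
      q.choose y.1 * (zigzag (a + y.1) * entringer (b + 1) y.2)), sum_range]
  refine sum_congr rfl fun i _ => ?_
  rw [Nat.sum_antidiagonal_eq_sum_range_succ
    (fun a b => q.choose a * (zigzag (i + a) * entringer (p - i + 1) b)), sum_range,
    mul_sum]
  refine sum_congr rfl fun j _ => ?_
  ring

theorem entringer_zero_right (n : ℕ) : entringer n 0 = zigzag n := by
  induction n using Nat.strong_induction_on with
  | _ n ih =>
    match n with
    | 0 => simp [entringer, zigzag]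
    | 1 => simp [entringer, zigzag]
    | n + 2 =>
      rw [entringer, zigzag]
      refine sum_congr rfl fun i _ => ?_
      simp [ih (n - i + 1) (by omega)]

theorem zigzag_add_two (n : ℕ) : zigzag (n + 2) =
    ∑ x ∈ antidiagonal n, n.choose x.1 * (zigzag x.1 * zigzag (x.2 + 1)) := by
  rw [zigzag, Nat.sum_antidiagonal_eq_sum_range_succ
    (fun a b => n.choose a * (zigzag a * zigzag (b + 1))), sum_range]
  simp only [mul_assoc]

theorem sum_choose_zigzag_sq (n : ℕ) :
    ∑ x ∈ antidiagonal (n + 1), (n + 1).choose x.1 * (zigzag x.1 * zigzag x.2) =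
      2 * zigzag (n + 2) := by
  have := Finset.sum_antidiagonal_choose_succ_mul (R := ℕ) (fun a b => zigzag a * zigzag b) n
  simp only [Nat.cast_id] at this
  rw [this, zigzag_add_two, two_mul]
  congr 1
  rw [← Nat.sum_antidiagonal_swap]
  refine sum_congr rfl fun x _ => ?_
  simp only [Prod.fst_swap, Prod.snd_swap]
  ring

theorem entringer_two (q : ℕ) :
    entringer 2 q = ∑ x ∈ antidiagonal q, q.choose x.1 * (zigzag x.1 * zigzag x.2) := by
  rw [entringer_add_two]
  simp [binomConv, entringer_one]

/-- If the Entringer recurrence holds below degree `d`, the recurrence that removes a small letter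
has a mirror image that removes a large letter. -/
theorem entringer_right_add_two_of_rec {d : ℕ}
    (ih : ∀ p q, p + q < d → entringer (p + 1) q = entringer p (q + 1) + entringer q p)
    (p q : ℕ) (h : p + q + 2 ≤ d) :
    entringer p (q + 2) = binomConv zigzag (fun i j => entringer i (j + 1)) p q := by
  induction p generalizing q with
  | zero => simp [binomConv, entringer_zero_succ]
  | succ p ihp =>
    have h1 := ihp (q + 1) (by omega)
    rw [binomConv_succ_right] at h1
    rw [ih _ _ (by omega), entringer_add_two, binomConv_succ_left, h1, binomConv_swap _ _ p q,
      binomConv_congr _ (f := fun i j => entringer (i + 1) (j + 1))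
        (g := fun i j => entringer i (j + 1 + 1) + entringer (j + 1) i)
        (fun i j hi hj => ih _ _ (by omega)), binomConv_add]
    ring

theorem entringer_rec (p q : ℕ) :
    entringer (p + 1) q = entringer p (q + 1) + entringer q p := by
  induction hd : p + q using Nat.strong_induction_on generalizing p q with
  | _ d ih =>
    replace ih : ∀ p q, p + q < d → entringer (p + 1) q = entringer p (q + 1) + entringer q p :=
      fun p q h => ih _ h p q rfl
    match p with
    | 0 => simp [entringer_zero_succ, entringer_one, entringer_zero_right]
    | 1 =>
      match q with
      | 0 => simp [entringer_two, zigzag, entringer]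
      | q + 1 =>
        have h1 := ih (q + 1) 0 (by omega)
        rw [entringer_zero_right, entringer_zero_succ, zero_add] at h1
        rw [entringer_two, sum_choose_zigzag_sq, entringer_one]
        linarith
    | p + 2 =>
      have h1 := entringer_right_add_two_of_rec ih q p (by omega)
      rw [entringer_add_two, entringer_add_two, binomConv_succ_left, binomConv_succ_right, h1,
        binomConv_swap _ _ p q,
        binomConv_congr _ (f := fun i j => entringer (i + 1 + 1) j)
          (g := fun i j => entringer (i + 1) (j + 1) + entringer j (i + 1))
          (fun i j hi hj => ih _ _ (by omega)), binomConv_add]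
      ring

/-- The signed count with last entry `m + 1`, where `n = m + r + 1`. -/
def arnoldPos (m r : ℕ) : ℕ :=
  2 ^ m * ∑ x ∈ antidiagonal r, r.choose x.1 * entringer (m + x.1) x.2

/-- The signed count with last entry `-(m + 1)`, where `n = m + r + 1`. -/
def arnoldNeg (m r : ℕ) : ℕ :=
  2 ^ m * ∑ x ∈ antidiagonal r, r.choose x.1 * entringer x.1 (m + x.2)

theorem sum_choose_succ (r : ℕ) (f : ℕ → ℕ → ℕ) :
    ∑ x ∈ antidiagonal (r + 1), (r + 1).choose x.1 * f x.1 x.2 =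
      ∑ x ∈ antidiagonal r, r.choose x.1 * (f x.1 (x.2 + 1) + f (x.1 + 1) x.2) := by
  have := Finset.sum_antidiagonal_choose_succ_mul (R := ℕ) f r
  simp only [Nat.cast_id] at this
  simp only [this, mul_add, sum_add_distrib]
  congr 1
  refine sum_congr rfl fun x hx => ?_
  rw [← Nat.choose_symm_of_eq_add (mem_antidiagonal.1 hx).symm]

theorem sum_choose_swap (r : ℕ) (f : ℕ → ℕ → ℕ) :
    ∑ x ∈ antidiagonal r, r.choose x.1 * f x.2 x.1 =
      ∑ x ∈ antidiagonal r, r.choose x.1 * f x.1 x.2 := by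
  rw [← Nat.sum_antidiagonal_swap]
  refine sum_congr rfl fun x hx => ?_
  rw [Prod.fst_swap, Prod.snd_swap, ← Nat.choose_symm_of_eq_add (mem_antidiagonal.1 hx).symm]

theorem arnoldPos_zero_left (r : ℕ) : arnoldPos 0 r = arnoldNeg 0 r := by
  simp [arnoldPos, arnoldNeg]

theorem arnoldNeg_zero_right (m : ℕ) : arnoldNeg (m + 1) 0 = 0 := by
  simp [arnoldNeg, entringer_zero_succ]

theorem arnoldPos_succ (m r : ℕ) :
    arnoldPos (m + 1) r = arnoldPos m (r + 1) + arnoldNeg m r := by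
  unfold arnoldPos arnoldNeg
  rw [sum_choose_succ r (fun a b => entringer (m + a) b),
    ← sum_choose_swap r (fun a b => entringer a (m + b)), ← mul_add, ← sum_add_distrib, pow_succ,
    mul_assoc, mul_sum]
  congr 1
  refine sum_congr rfl fun x _ => ?_
  have := entringer_rec (m + x.1) x.2
  rw [show m + 1 + x.1 = m + x.1 + 1 by ring, show m + (x.1 + 1) = m + x.1 + 1 by ring]
  linear_combination (r.choose x.1) * this

theorem arnoldNeg_succ (m r : ℕ) :
    arnoldNeg m (r + 1) = arnoldNeg (m + 1) r + arnoldPos m r := by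
  unfold arnoldPos arnoldNeg
  rw [sum_choose_succ r (fun a b => entringer a (m + b)),
    ← sum_choose_swap r (fun a b => entringer (m + a) b), pow_succ, mul_assoc, ← mul_add]
  congr 1
  rw [mul_sum, ← sum_add_distrib]
  refine sum_congr rfl fun x _ => ?_
  have := entringer_rec x.1 (m + x.2)
  rw [show m + 1 + x.2 = m + x.2 + 1 by ring, show m + (x.2 + 1) = m + x.2 + 1 by ring]
  linear_combination (r.choose x.1) * this

theorem eq_arnold_of_rec
    (S : ℕ → ℤ → ℕ)
    (hS11 : S 1 1 = 1) (hS1m1 : S 1 (-1) = 1)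
    (hSnn : ∀ n : ℕ, 2 ≤ n → S n (-(n : ℤ)) = 0)
    (hSpos : ∀ (n : ℕ) (k : ℤ), 1 < k → k ≤ (n : ℤ) →
      S n k = S n (k - 1) + S (n - 1) (-k + 1))
    (hSone : ∀ n : ℕ, 1 < n → S n 1 = S n (-1))
    (hSneg : ∀ (n : ℕ) (k : ℤ), -(n : ℤ) < k → k ≤ -1 →
      S n k = S n (k - 1) + S (n - 1) (-k))
    (n m r : ℕ) (hn : n = m + r + 1) :
    S n (m + 1) = arnoldPos m r ∧ S n (-(m + 1)) = arnoldNeg m r := by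
  induction n generalizing m r with
  | zero => omega
  | succ n ih =>
    have hneg : ∀ r m, n + 1 = m + r + 1 → S (n + 1) (-(m + 1)) = arnoldNeg m r := by
      intro r
      induction r with
      | zero =>
        intro m h
        obtain rfl : n = m := by omega
        match n with
        | 0 => simpa [arnoldNeg, entringer] using hS1m1
        | n + 1 => simpa [arnoldNeg_zero_right] using hSnn (n + 1 + 1) (by omega)
      | succ r ihr =>
        intro m h
        rw [arnoldNeg_succ, ← ihr (m + 1) (by omega), ← (ih m r (by omega)).1,
          hSneg _ _ (by push_cast; omega) (by omega)]
        push_cast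
        congr 2
    refine ⟨?_, hneg r m hn⟩
    induction m generalizing r with
    | zero =>
      rw [arnoldPos_zero_left, ← hneg r 0 hn]
      rcases Nat.eq_zero_or_pos n with rfl | h
      · simp [hS11, hS1m1]
      · simpa using hSone (n + 1) (by omega)
    | succ m ihm =>
      rw [arnoldPos_succ, ← ihm (r + 1) (by omega), ← (ih m r (by omega)).2,
        hSpos _ _ (by push_cast; omega) (by push_cast; omega)]
      push_cast
      congr 2
      ring

section Words

/-- A word without double descents that ends with an ascent. -/
def GoodWord (w : List ℤ) : Prop :=
  ¬ HasDoubleDescent w ∧ EndsWithAscent w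

theorem not_goodWord_nil : ¬ GoodWord [] := by
  simp [GoodWord, EndsWithAscent]

theorem goodWord_singleton (x : ℤ) : GoodWord [x] := by
  simp [GoodWord, EndsWithAscent, HasDoubleDescent]

theorem goodWord_pair (x y : ℤ) : GoodWord [x, y] ↔ x < y := by
  simp [GoodWord, EndsWithAscent, HasDoubleDescent]

theorem hasDoubleDescent_cons (x y z : ℤ) (l : List ℤ) :
    HasDoubleDescent (x :: y :: z :: l) ↔ (y < x ∧ z < y) ∨ HasDoubleDescent (y :: z :: l) := by
  constructor
  · rintro ⟨i, h, h1, h2⟩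
    match i with
    | 0 => exact Or.inl ⟨h1, h2⟩
    | i + 1 => exact Or.inr ⟨i, by simpa using h, h1, h2⟩
  · rintro (⟨h1, h2⟩ | ⟨i, h, h1, h2⟩)
    · exact ⟨0, by simp, h1, h2⟩
    · exact ⟨i + 1, by simpa using h, h1, h2⟩

theorem endsWithAscent_cons (x y z : ℤ) (l : List ℤ) :
    EndsWithAscent (x :: y :: z :: l) ↔ EndsWithAscent (y :: z :: l) := by
  simp [EndsWithAscent]

theorem goodWord_cons (x y z : ℤ) (l : List ℤ) :
    GoodWord (x :: y :: z :: l) ↔ ¬ (y < x ∧ z < y) ∧ GoodWord (y :: z :: l) := by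
  rw [GoodWord, GoodWord, hasDoubleDescent_cons, endsWithAscent_cons]
  tauto

theorem goodWord_min_cons {m : ℤ} {v : List ℤ} (hv : ∀ x ∈ v, m < x) :
    GoodWord (m :: v) ↔ v = [] ∨ GoodWord v := by
  match v with
  | [] => simp [goodWord_singleton]
  | [y] => simpa [goodWord_pair, goodWord_singleton] using hv
  | y :: z :: l =>
    have := hv y (by simp)
    simp only [goodWord_cons, reduceCtorEq, false_or]
    have : ¬ (y < m ∧ z < y) := by omega
    tauto

theorem goodWord_append_min {m : ℤ} {u v : List ℤ} (hd : u.Nodup) (hu : ∀ x ∈ u, m < x)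
    (hv : ∀ x ∈ v, m < x) :
    GoodWord (u ++ m :: v) ↔
      (u = [] ∨ GoodWord u) ∧ ((u = [] ∧ v = []) ∨ GoodWord v) := by
  match u with
  | [] => simp [goodWord_min_cons hv]
  | [x] =>
    have hx : m < x := hu x (by simp)
    match v with
    | [] => simp [goodWord_pair, not_goodWord_nil, hx.le]
    | y :: l =>
      have hy : m < y := hv y (by simp)
      have := goodWord_min_cons hv
      have h' : ¬ (m < x ∧ y < m) := by omega
      simp_all [goodWord_cons, goodWord_singleton]
  | [x, y] =>
    have hy : m < y := hu y (by simp)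
    have := goodWord_append_min (u := [y]) (by simp) (by simpa using hy) hv
    simp only [List.cons_append, List.nil_append] at this ⊢
    rw [goodWord_cons, this, goodWord_pair]
    simp [goodWord_singleton, hy]
    have hxy : x ≠ y := by simpa using hd
    exact fun _ => hxy.le_iff_lt
  | x :: y :: z :: u =>
    have := goodWord_append_min (u := y :: z :: u) hd.of_cons (fun a ha => hu a (by simp_all)) hv
    simp only [List.cons_append] at this ⊢
    rw [goodWord_cons, this, goodWord_cons]
    simp [and_assoc]

/-- A word whose nonempty restrictions to small letters are all good. -/
def AndreWord (l : List ℤ) : Prop :=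
  ∀ t : ℤ, l.filter (· ≤ t) ≠ [] → GoodWord (l.filter (· ≤ t))

theorem andreWord_nil : AndreWord [] := by simp [AndreWord]

theorem andreWord_singleton (x : ℤ) : AndreWord [x] := by
  intro t
  by_cases h : x ≤ t <;> simp [h, goodWord_singleton]

theorem andreWord_append_min {m : ℤ} {u v : List ℤ} (hd : u.Nodup)
    (hu : ∀ x ∈ u, m < x) (hv : ∀ x ∈ v, m < x) :
    AndreWord (u ++ m :: v) ↔ AndreWord u ∧ AndreWord v ∧ ∀ x ∈ u, ∃ y ∈ v, y ≤ x := by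
  have key : ∀ t, m ≤ t → (GoodWord ((u ++ m :: v).filter (· ≤ t)) ↔
      (u.filter (· ≤ t) = [] ∨ GoodWord (u.filter (· ≤ t))) ∧
      ((u.filter (· ≤ t) = [] ∧ v.filter (· ≤ t) = []) ∨ GoodWord (v.filter (· ≤ t)))) := by
    intro t ht
    rw [List.filter_append, List.filter_cons_of_pos (by simpa using ht)]
    exact goodWord_append_min (hd.filter _) (fun x hx => hu x (List.mem_of_mem_filter hx))
      (fun x hx => hv x (List.mem_of_mem_filter hx))
  have hle : ∀ w : List ℤ, (∀ x ∈ w, m < x) → ∀ t, w.filter (· ≤ t) ≠ [] → m ≤ t := by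
    intro w hw t h
    obtain ⟨x, hx⟩ := List.exists_mem_of_ne_nil _ h
    rw [List.mem_filter] at hx
    have := hw x hx.1
    have : x ≤ t := by simpa using hx.2
    omega
  have hgood : AndreWord (u ++ m :: v) → ∀ t, m ≤ t → GoodWord ((u ++ m :: v).filter (· ≤ t)) :=
    fun h t ht => h t (by simp [ht])
  constructor
  · intro h
    refine ⟨fun t ht => ?_, fun t ht => ?_, fun x hx => ?_⟩
    · have := (key t (hle u hu t ht)).1 (hgood h t (hle u hu t ht))
      tauto
    · have := (key t (hle v hv t ht)).1 (hgood h t (hle v hv t ht))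
      tauto
    · have hm := (hu x hx).le
      have h1 := ((key x hm).1 (hgood h x hm)).2
      have h2 : u.filter (· ≤ x) ≠ [] := List.ne_nil_of_mem (List.mem_filter.2 ⟨hx, by simp⟩)
      have h3 : v.filter (· ≤ x) ≠ [] := by
        intro h3
        rw [h3] at h1
        have := not_goodWord_nil
        tauto
      obtain ⟨y, hy⟩ := List.exists_mem_of_ne_nil _ h3
      rw [List.mem_filter] at hy
      exact ⟨y, hy.1, by simpa using hy.2⟩
  · rintro ⟨h1, h2, h3⟩ t ht
    have hm : m ≤ t := by
      obtain ⟨x, hx⟩ := List.exists_mem_of_ne_nil _ ht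
      simp only [List.mem_filter, List.mem_append, List.mem_cons, decide_eq_true_eq] at hx
      rcases hx with ⟨hx | rfl | hx, h⟩
      · exact (hu x hx).le.trans h
      · exact h
      · exact (hv x hx).le.trans h
    refine (key t hm).2 ⟨?_, ?_⟩
    · have := h1 t
      tauto
    · by_cases hv' : v.filter (· ≤ t) = []
      · left
        refine ⟨?_, hv'⟩
        rw [List.filter_eq_nil_iff] at hv' ⊢
        intro x hx hxt
        obtain ⟨y, hy, hyx⟩ := h3 x hx
        exact hv' y hy (by simp at hxt ⊢; omega)
      · exact Or.inr (h2 t hv')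

theorem countP_le_lt_countP_le {l : List ℤ} {t x : ℤ} (hx : x ∈ l) (h : t < x) :
    l.countP (· ≤ t) < l.countP (· ≤ x) := by
  induction l with
  | nil => simp at hx
  | cons a l ih =>
    have hmono : l.countP (· ≤ t) ≤ l.countP (· ≤ x) :=
      List.countP_mono_left fun y _ hy => by simp at hy ⊢; omega
    rw [List.countP_cons, List.countP_cons]
    rcases List.mem_cons.1 hx with rfl | hx
    · have : ¬ x ≤ t := by omega
      simp only [this]
      grind
    · have := ih hx
      by_cases h1 : a ≤ t
      · have : a ≤ x := by omega
        simp [*]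
      · simp only [h1]
        grind

theorem countP_le_le_countP_le_iff {l : List ℤ} {t x : ℤ} (hx : x ∈ l) :
    l.countP (· ≤ x) ≤ l.countP (· ≤ t) ↔ x ≤ t := by
  refine ⟨fun h => ?_, fun h => List.countP_mono_left fun y _ hy => by simp at hy ⊢; omega⟩
  by_contra! h'
  exact absurd (countP_le_lt_countP_le hx h') (by omega)

theorem andreWord_iff_lowerSubword {l : List ℤ} (hl : l.Nodup) :
    AndreWord l ↔ ∀ k : ℕ, 1 ≤ k → k ≤ l.length → GoodWord (lowerSubword l k) := by
  constructor
  · intro h k hk hkl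
    have hne : l.toFinset.Nonempty := by
      rw [List.toFinset_nonempty_iff]
      rintro rfl
      simp at hkl
      omega
    obtain ⟨m, hm, hmin⟩ := l.toFinset.exists_min_image id hne
    simp only [List.mem_toFinset, id] at hm hmin
    have hm1 : l.countP (· ≤ m) = 1 := by
      rw [← List.count_eq_one_of_mem hl hm, List.count]
      refine List.countP_congr fun x hx => ?_
      have := hmin x hx
      simp
      omega
    have hne : (lowerSubword l k).toFinset.Nonempty := by
      refine ⟨m, ?_⟩
      simp [lowerSubword, hm, hm1, hk]
    obtain ⟨t, ht, hmax⟩ := (lowerSubword l k).toFinset.exists_max_image id hne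
    simp only [lowerSubword, List.mem_toFinset, List.mem_filter, id, decide_eq_true_eq] at ht hmax
    have heq : lowerSubword l k = l.filter (· ≤ t) := by
      refine List.filter_congr fun x hx => ?_
      simp only [decide_eq_decide]
      exact ⟨fun h => hmax x ⟨hx, h⟩, fun h => ((countP_le_le_countP_le_iff hx).2 h).trans ht.2⟩
    rw [heq]
    exact h t (List.ne_nil_of_mem (List.mem_filter.2 ⟨ht.1, by simp⟩))
  · intro h t ht
    have heq : lowerSubword l (l.countP (· ≤ t)) = l.filter (· ≤ t) := by
      refine List.filter_congr fun x hx => ?_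
      simp only [decide_eq_decide]
      exact countP_le_le_countP_le_iff hx
    rw [← heq]
    refine h _ ?_ List.countP_le_length
    rw [List.countP_eq_length_filter]
    exact List.length_pos_iff.2 ht

end Words

section Counting

open Classical in
/-- The André words with letter set `V` whose last letter satisfies `Q`. -/
noncomputable def andreWords (V : Finset ℤ) (Q : Option ℤ → Prop) : Finset (List ℤ) :=
  (Multiset.lists V.val).toFinset.filter fun l => AndreWord l ∧ Q l.getLast?

variable {V R : Finset ℤ} {Q : Option ℤ → Prop} {l : List ℤ} {m s v : ℤ}

theorem mem_andreWords :
    l ∈ andreWords V Q ↔ (l.Nodup ∧ ∀ x, x ∈ l ↔ x ∈ V) ∧ AndreWord l ∧ Q l.getLast? := by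
  classical
  rw [andreWords, mem_filter, Multiset.mem_toFinset, Multiset.mem_lists_iff]
  refine and_congr_left fun _ => ⟨fun h => ?_, fun ⟨h1, h2⟩ => ?_⟩
  · have h' : V.val = (l : Multiset ℤ) := h
    refine ⟨?_, fun x => ?_⟩
    · rw [← Multiset.coe_nodup, ← h']
      exact V.nodup
    · rw [← Finset.mem_val, h', Multiset.mem_coe]
  · have : V = ⟨l, Multiset.coe_nodup.2 h1⟩ := by
      ext x
      simp [← h2]
    rw [this]
    rfl

theorem card_andreWords_insert_insert (hms : m < s) (hR : ∀ x ∈ R, s < x) :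
    #(andreWords (insert m (insert s R)) Q) =
      ∑ U ∈ R.powerset, #(andreWords U fun _ => True) * #(andreWords (insert s (R \ U)) Q) := by
  simp_rw [← card_product]
  rw [← card_sigma]
  symm
  refine card_bij (fun x _ => x.2.1 ++ m :: x.2.2) ?_ ?_ ?_
  · rintro ⟨U, u, v⟩ h
    simp only [mem_sigma, mem_powerset, mem_product, mem_andreWords] at h
    obtain ⟨hU, ⟨⟨hu1, hu2⟩, hu3, -⟩, ⟨hv1, hv2⟩, hv3, hv4⟩ := h
    have hsv : s ∈ v := by simp [hv2]
    have hu : ∀ x ∈ u, s < x := fun x hx => hR x (hU ((hu2 x).1 hx))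
    have hv : ∀ x ∈ v, s ≤ x := by
      intro x hx
      rcases mem_insert.1 ((hv2 x).1 hx) with rfl | h
      · exact le_rfl
      · exact (hR x (mem_sdiff.1 h).1).le
    rw [mem_andreWords]
    refine ⟨⟨?_, fun x => ?_⟩, (andreWord_append_min hu1 (fun x hx => hms.trans (hu x hx))
      (fun x hx => hms.trans_le (hv x hx))).2 ⟨hu3, hv3, fun x hx => ⟨s, hsv, (hu x hx).le⟩⟩, ?_⟩
    · rw [List.nodup_append, List.nodup_cons]
      refine ⟨hu1, ⟨fun h => (hv m h).not_gt hms, hv1⟩, ?_⟩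
      rintro a ha b hb rfl
      rcases List.mem_cons.1 hb with rfl | hb
      · exact (hu a ha).not_gt hms
      · rw [hu2] at ha
        rw [hv2, mem_insert, mem_sdiff] at hb
        rcases hb with rfl | hb
        · exact lt_irrefl _ (hR a (hU ha))
        · exact hb.2 ha
    · have := @hU x
      simp only [List.mem_append, List.mem_cons, hu2, hv2, mem_insert, mem_sdiff]
      tauto
    · rw [List.getLast?_append, List.getLast?_cons]
      obtain ⟨a, ha⟩ := Option.isSome_iff_exists.1
        (List.getLast?_isSome.2 (List.ne_nil_of_mem hsv))
      rw [ha] at hv4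
      simpa [ha] using hv4
  · rintro ⟨U, u, v⟩ h ⟨U', u', v'⟩ h' heq
    simp only [mem_sigma, mem_powerset, mem_product, mem_andreWords] at h h'
    obtain ⟨hU, ⟨⟨-, hu2⟩, -⟩, ⟨-, hv2⟩, -⟩ := h
    obtain ⟨-, ⟨⟨-, hu2'⟩, -⟩, -⟩ := h'
    have hm : m ∉ R := fun h => (hR m h).not_gt hms
    have h1 : m ∉ u := fun h => hm (hU ((hu2 m).1 h))
    have h2 : m ∉ v := by
      rw [hv2, mem_insert, mem_sdiff]
      exact not_or.2 ⟨hms.ne, fun h => hm h.1⟩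
    obtain ⟨rfl, -, rfl⟩ := (List.append_cons_inj_of_notMem h1 h2).1 heq
    obtain rfl : U = U' := by
      ext x
      rw [← hu2, ← hu2']
    rfl
  · intro l hl
    rw [mem_andreWords] at hl
    obtain ⟨⟨hl1, hl2⟩, hl3, hl4⟩ := hl
    obtain ⟨u, v, rfl⟩ := List.append_of_mem ((hl2 m).2 (mem_insert_self _ _))
    rw [List.nodup_append, List.nodup_cons] at hl1
    obtain ⟨hu1, ⟨hmv, hv1⟩, huv⟩ := hl1
    have hmu : m ∉ u := fun h => huv m h m (by simp) rfl
    have hlt : ∀ x, x ∈ u ∨ x ∈ v → m < x := by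
      intro x hx
      have h := (hl2 x).1 (by simp; tauto)
      rcases mem_insert.1 h with rfl | h
      · tauto
      · rcases mem_insert.1 h with rfl | h
        · exact hms
        · exact hms.trans (hR x h)
    rw [andreWord_append_min hu1 (fun x hx => hlt x (.inl hx)) (fun x hx => hlt x (.inr hx))] at hl3
    obtain ⟨hu3, hv3, hle⟩ := hl3
    have hsu : s ∉ u := by
      intro hs
      obtain ⟨y, hy, hys⟩ := hle s hs
      have hy1 := hlt y (.inr hy)
      have hy2 := (hl2 y).1 (by simp [hy])
      rw [mem_insert, mem_insert] at hy2
      rcases hy2 with rfl | rfl | hy2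
      · exact lt_irrefl _ hy1
      · exact huv y hs y (by simp [hy]) rfl
      · exact (hR y hy2).not_ge hys
    have hmem : ∀ x, x ∈ u ∨ x ∈ v ↔ x = s ∨ x ∈ R := by
      intro x
      have h := hl2 x
      simp only [List.mem_append, List.mem_cons, mem_insert] at h
      by_cases hx : x = m
      · subst hx
        have : x ∉ R := fun h => (hR x h).not_gt hms
        have := hms.ne
        tauto
      · tauto
    have hsv : s ∈ v := by
      have := hmem s
      tauto
    refine ⟨⟨u.toFinset, u, v⟩, ?_, rfl⟩
    simp only [mem_sigma, mem_powerset, mem_product, mem_andreWords]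
    refine ⟨fun x hx => ?_, ⟨⟨hu1, by simp⟩, hu3, trivial⟩, ⟨hv1, fun x => ?_⟩, hv3, ?_⟩
    · rw [List.mem_toFinset] at hx
      rcases (hmem x).1 (.inl hx) with rfl | h
      · exact absurd hx hsu
      · exact h
    · have h1 := hmem x
      have h2 : x ∈ u → x ∉ v := fun h h' => huv x h x (by simp [h']) rfl
      simp only [mem_insert, mem_sdiff, List.mem_toFinset]
      by_cases hx : x = s
      · subst hx
        tauto
      · tauto
    · rw [List.getLast?_append, List.getLast?_cons] at hl4
      obtain ⟨a, ha⟩ := Option.isSome_iff_exists.1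
        (List.getLast?_isSome.2 (List.ne_nil_of_mem hsv))
      rw [ha]
      simpa [ha] using hl4

theorem exists_eq_insert_insert (hV : 2 ≤ #V) :
    ∃ m s R, m < s ∧ (∀ x ∈ R, s < x) ∧ V = insert m (insert s R) ∧ #V = #R + 2 := by
  have h1 : V.Nonempty := card_pos.1 (by omega)
  have hc := card_erase_of_mem (V.min'_mem h1)
  have h2 : (V.erase (V.min' h1)).Nonempty := card_pos.1 (by omega)
  have hc2 := card_erase_of_mem ((V.erase (V.min' h1)).min'_mem h2)
  refine ⟨V.min' h1, (V.erase (V.min' h1)).min' h2, _,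
    V.min'_lt_of_mem_erase_min' h1 (min'_mem _ _),
    fun x hx => min'_lt_of_mem_erase_min' _ _ hx, ?_, by omega⟩
  rw [insert_erase (min'_mem _ _), insert_erase (min'_mem _ _)]

theorem andreWords_singleton (hQ : Q (some m)) : andreWords {m} Q = {[m]} := by
  ext l
  rw [mem_andreWords, mem_singleton]
  constructor
  · rintro ⟨⟨h1, h2⟩, -⟩
    refine List.perm_singleton.1 ((List.perm_ext_iff_of_nodup h1 (by simp)).2 ?_)
    simpa using h2
  · rintro rfl
    exact ⟨by simp, andreWord_singleton m, by simpa using hQ⟩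

theorem andreWords_empty : andreWords ∅ (fun _ => True) = {[]} := by
  ext l
  rw [mem_andreWords, mem_singleton]
  constructor
  · rintro ⟨⟨-, h2⟩, -⟩
    exact List.eq_nil_iff_forall_not_mem.2 (by simpa using h2)
  · rintro rfl
    simp [andreWord_nil]

theorem card_andreWords (V : Finset ℤ) : #(andreWords V fun _ => True) = zigzag #V := by
  induction hn : #V using Nat.strong_induction_on generalizing V with
  | _ n ih =>
    match n with
    | 0 =>
      rw [card_eq_zero.1 hn, andreWords_empty]
      simp [zigzag]
    | 1 =>
      obtain ⟨m, rfl⟩ := card_eq_one.1 hn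
      rw [andreWords_singleton trivial]
      simp [zigzag]
    | n + 2 =>
      obtain ⟨m, s, R, hms, hR, rfl, hc⟩ := exists_eq_insert_insert (V := V) (by omega)
      obtain rfl : n = #R := by omega
      rw [card_andreWords_insert_insert hms hR, zigzag_add_two,
        Nat.sum_antidiagonal_eq_sum_range_succ
          (fun a b => (#R).choose a * (zigzag a * zigzag (b + 1)))]
      have := sum_powerset_apply_card (fun a => zigzag a * zigzag (#R - a + 1)) (x := R)
      simp only [smul_eq_mul] at this
      rw [← this]
      refine sum_congr rfl fun U hU => ?_
      rw [mem_powerset] at hU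
      have hs : s ∉ R \ U := fun h => lt_irrefl _ (hR s (mem_sdiff.1 h).1)
      have hc := card_insert_of_notMem hs
      rw [card_sdiff_of_subset hU] at hc
      have := card_le_card hU
      rw [ih _ (by omega) U rfl, ih _ (by omega) _ hc]

theorem andreWords_eq_empty_of_notMem (hv : v ∉ V) : andreWords V (· = some v) = ∅ := by
  refine eq_empty_of_forall_notMem fun l hl => ?_
  rw [mem_andreWords] at hl
  exact hv ((hl.1.2 v).1 (List.mem_of_getLast? hl.2.2))

theorem sum_powerset_union {B C : Finset ℤ} (hBC : Disjoint B C) (f : Finset ℤ → ℕ)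
    (g : ℕ → ℕ → ℕ) (hf : ∀ X ⊆ B, ∀ Y ⊆ C, f (X ∪ Y) = g #X #Y) :
    ∑ U ∈ (B ∪ C).powerset, f U = ∑ i ∈ range (#B + 1), (#B).choose i *
      ∑ j ∈ range (#C + 1), (#C).choose j * g i j := by
  have h1 : ∑ U ∈ (B ∪ C).powerset, f U =
      ∑ X ∈ B.powerset, ∑ Y ∈ C.powerset, g #X #Y := by
    rw [← sum_product']
    refine sum_nbij' (fun U => (U ∩ B, U ∩ C)) (fun x => x.1 ∪ x.2) ?_ ?_ ?_ ?_ ?_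
    · intro U _
      simp
    · rintro ⟨X, Y⟩ h
      simp only [mem_product, mem_powerset] at h ⊢
      exact union_subset_union h.1 h.2
    · intro U hU
      rw [mem_powerset] at hU
      simp only
      rw [← inter_union_distrib_left, inter_eq_left.2 hU]
    · rintro ⟨X, Y⟩ h
      simp only [mem_product, mem_powerset] at h
      have h1 := (hBC.mono_left h.1)
      have h2 := (hBC.mono_right h.2)
      simp only [union_inter_distrib_right, inter_eq_left.2 h.1, inter_eq_left.2 h.2,
        disjoint_iff_inter_eq_empty.1 h1, disjoint_iff_inter_eq_empty.1 h2.symm, union_empty,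
        empty_union]
    · intro U hU
      rw [mem_powerset] at hU
      rw [← hf _ inter_subset_right _ inter_subset_right, ← inter_union_distrib_left,
        inter_eq_left.2 hU]
  have h2 : ∀ i, ∑ Y ∈ C.powerset, g i #Y = ∑ j ∈ range (#C + 1), (#C).choose j * g i j :=
    fun i => by simpa using sum_powerset_apply_card (fun j => g i j) (x := C)
  simp_rw [h1, h2]
  simpa using sum_powerset_apply_card
    (fun i => ∑ j ∈ range (#C + 1), (#C).choose j * g i j) (x := B)

theorem card_andreWords_last (hv : v ∈ V) :
    #(andreWords V (· = some v)) = entringer #{x ∈ V | x < v} #{x ∈ V | v < x} := by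
  induction hn : #V using Nat.strong_induction_on generalizing V with
  | _ n ih =>
    match n with
    | 0 => simp [card_eq_zero.1 hn] at hv
    | 1 =>
      obtain ⟨m, rfl⟩ := card_eq_one.1 hn
      obtain rfl : v = m := by simpa using hv
      rw [andreWords_singleton (Q := (· = some v)) rfl]
      simp [entringer, filter_singleton]
    | n + 2 =>
      obtain ⟨m, s, R, hms, hR, rfl, hc⟩ := exists_eq_insert_insert (V := V) (by omega)
      have hmR : ∀ x ∈ R, m < x := fun x hx => hms.trans (hR x hx)
      have hsR : s ∉ R := fun h => lt_irrefl _ (hR s h)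
      rw [card_andreWords_insert_insert hms hR]
      simp only [card_andreWords]
      have ihU : ∀ U ⊆ R, v ∈ insert s (R \ U) → #(andreWords (insert s (R \ U)) (· = some v)) =
          entringer #{x ∈ insert s (R \ U) | x < v} #{x ∈ insert s (R \ U) | v < x} := by
        intro U hU hv
        refine ih _ ?_ hv rfl
        have := card_insert_le s (R \ U)
        have := card_le_card (sdiff_subset (s := R) (t := U))
        omega
      clear ih hn hc
      rw [mem_insert, mem_insert] at hv
      rcases hv with rfl | rfl | hv
      · clear ihU
        have h1 : #{x ∈ insert v (insert s R) | x < v} = 0 := by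
          rw [card_eq_zero, filter_eq_empty_iff]
          grind
        have h2 : 0 < #{x ∈ insert v (insert s R) | v < x} :=
          card_pos.2 ⟨s, by simp [hms]⟩
        obtain ⟨q, hq⟩ := Nat.exists_eq_succ_of_ne_zero h2.ne'
        rw [h1, hq, Nat.succ_eq_add_one, entringer_zero_succ]
        refine sum_eq_zero fun U hU => ?_
        rw [andreWords_eq_empty_of_notMem, card_empty, mul_zero]
        grind
      · have h1 : {x ∈ insert m (insert v R) | x < v} = {m} := by clear ihU; grind
        have h2 : {x ∈ insert m (insert v R) | v < x} = R := by clear ihU; grind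
        rw [h1, h2, card_singleton, entringer_one, sum_eq_single_of_mem R (by simp)]
        · rw [ihU R subset_rfl (by simp)]
          simp [filter_singleton, entringer]
        · intro U hU hne
          rw [mem_powerset] at hU
          have h1 : {x ∈ insert v (R \ U) | x < v} = ∅ := by clear ihU; grind
          have h2 : {x ∈ insert v (R \ U) | v < x} = R \ U := by clear ihU; grind
          have h3 : #(R \ U) ≠ 0 := by
            rw [card_ne_zero, sdiff_nonempty]
            exact fun h => hne (hU.antisymm h)
          obtain ⟨q, hq⟩ := Nat.exists_eq_succ_of_ne_zero h3
          rw [ihU U hU (by simp), h1, h2, hq, card_empty, Nat.succ_eq_add_one,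
            entringer_zero_succ, mul_zero]
      · have hsv := hR v hv
        set B := {x ∈ R | x < v} with hB
        set C := {x ∈ R | v < x} with hC
        have h1 : {x ∈ insert m (insert s R) | x < v} = insert m (insert s B) := by
          clear ihU; grind
        have h2 : {x ∈ insert m (insert s R) | v < x} = C := by clear ihU; grind
        have h3 : #(insert m (insert s B)) = #B + 2 := by
          clear ihU
          rw [card_insert_of_notMem (by grind), card_insert_of_notMem (by grind)]
        have hBC : Disjoint B C := by
          clear ihU
          rw [disjoint_left]
          grind
        have h4 : ∀ U ∈ R.powerset, U ∉ (B ∪ C).powerset →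
            zigzag #U * #(andreWords (insert s (R \ U)) (· = some v)) = 0 := by
          clear ihU
          intro U hU hU'
          rw [mem_powerset, not_subset] at hU'
          rw [mem_powerset] at hU
          rw [andreWords_eq_empty_of_notMem, card_empty, mul_zero]
          grind
        have h5 : ∀ X ⊆ B, ∀ Y ⊆ C,
            zigzag #(X ∪ Y) * #(andreWords (insert s (R \ (X ∪ Y))) (· = some v)) =
              zigzag (#X + #Y) * entringer (#B - #X + 1) (#C - #Y) := by
          intro X hX Y hY
          have hXY : X ∪ Y ⊆ R := by clear ihU; grind
          have hvXY : v ∈ insert s (R \ (X ∪ Y)) := by clear ihU; grind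
          have hd : Disjoint X Y := (hBC.mono_left hX).mono_right hY
          rw [disjoint_left] at hBC
          have h4 : {x ∈ insert s (R \ (X ∪ Y)) | x < v} = insert s (B \ X) := by
            clear ihU; ext; grind
          have h5 : {x ∈ insert s (R \ (X ∪ Y)) | v < x} = C \ Y := by
            clear ihU; ext; grind
          have hs : s ∉ B \ X := by clear ihU; grind
          rw [ihU _ hXY hvXY, h4, h5, card_union_of_disjoint hd,
            card_insert_of_notMem hs, card_sdiff_of_subset hX, card_sdiff_of_subset hY]
        have hBCR : (B ∪ C).powerset ⊆ R.powerset :=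
          powerset_mono.2 (union_subset (filter_subset _ _) (filter_subset _ _))
        rw [h1, h2, h3, entringer_add_two, binomConv, ← sum_subset hBCR h4,
          sum_powerset_union hBC _
            (fun i j => zigzag (i + j) * entringer (#B - i + 1) (#C - j)) h5]
        simp only [Nat.cast_id]
        rw [Nat.sum_antidiagonal_eq_sum_range_succ (fun a b => (#B).choose a *
            ∑ y ∈ antidiagonal #C, (#C).choose y.1 *
              (zigzag (a + y.1) * entringer (b + 1) y.2))]
        refine sum_congr rfl fun i _ => ?_
        rw [Nat.sum_antidiagonal_eq_sum_range_succ (fun a b => (#C).choose a *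
          (zigzag (i + a) * entringer (#B - i + 1) b))]

end Counting

section Signed

/-- The letters of a signed permutation whose letter `k` is fixed, in which the absolute values
in `T` carry a minus sign and those in `I \ T` do not. -/
def signSet (k : ℤ) (I T : Finset ℤ) : Finset ℤ :=
  insert k (T.image (fun x => -x) ∪ (I \ T))

variable {k x : ℤ} {I T : Finset ℤ} {n a r : ℕ} {l : List ℤ}

theorem mem_signSet : x ∈ signSet k I T ↔ x = k ∨ -x ∈ T ∨ x ∈ I ∧ x ∉ T := by
  simp [signSet, neg_eq_iff_eq_neg]

theorem signSet_injOn (hI : ∀ x ∈ I, 0 < x ∧ x ≠ k.natAbs) :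
    Set.InjOn (signSet k I) I.powerset := by
  have key : ∀ T ⊆ I, ∀ x ∈ I, x ∈ T ↔ -x ∈ signSet k I T := by
    intro T hT x hx
    have h1 := hI x hx
    have h2 : -x ∉ I := fun h => by have := hI _ h; omega
    have h3 : -x ≠ k := by omega
    rw [mem_signSet, neg_neg]
    tauto
  intro T hT T' hT' h
  rw [mem_coe, mem_powerset] at hT hT'
  ext x
  by_cases hx : x ∈ I
  · rw [key T hT x hx, key T' hT' x hx, h]
  · exact iff_of_false (fun h => hx (hT h)) (fun h => hx (hT' h))

theorem isSignedPerm_iff : IsSignedPerm n l ↔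
    (l.map Int.natAbs).Nodup ∧ ∀ j : ℕ, (∃ x ∈ l, x.natAbs = j) ↔ 1 ≤ j ∧ j ≤ n := by
  have h1 : ∀ j, j ∈ List.range' 1 n ↔ 1 ≤ j ∧ j ≤ n := by
    intro j
    rw [List.mem_range'_1]
    omega
  constructor
  · intro h
    refine ⟨h.nodup_iff.2 List.nodup_range', fun j => ?_⟩
    rw [← h1, ← h.mem_iff, List.mem_map]
  · rintro ⟨h2, h3⟩
    refine (List.perm_ext_iff_of_nodup h2 List.nodup_range').2 fun j => ?_
    rw [h1, ← h3, List.mem_map]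

theorem isSignedPerm_iff_exists_signSet (hk : 1 ≤ k.natAbs) (hkn : k.natAbs ≤ n)
    (hI : ∀ x, x ∈ I ↔ 1 ≤ x ∧ x ≤ n ∧ x ≠ k.natAbs) (hkl : k ∈ l) :
    IsSignedPerm n l ↔
      ∃ T ⊆ I, l.Nodup ∧ ∀ x, x ∈ l ↔ x ∈ signSet k I T := by
  rw [isSignedPerm_iff]
  constructor
  · rintro ⟨h1, h2⟩
    have hinj : ∀ x ∈ l, ∀ y ∈ l, x.natAbs = y.natAbs → x = y :=
      fun x hx y hy h => List.inj_on_of_nodup_map h1 hx hy h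
    refine ⟨{t ∈ I | -t ∈ l}, filter_subset _ _, h1.of_map _, fun x => ?_⟩
    simp only [mem_signSet, mem_filter, neg_neg, hI]
    have hx1 := hinj x
    have hx2 := hinj k hkl x
    have hx3 := hinj (-x)
    have h3 := h2 x.natAbs
    constructor
    · intro hx
      have h4 := h3.1 ⟨x, hx, rfl⟩
      by_cases hxk : x = k
      · exact .inl hxk
      have h5 : ¬ k.natAbs = x.natAbs := fun h => hxk (hx2 hx h).symm
      by_cases hx0 : x < 0
      · exact .inr (.inl ⟨by omega, hx⟩)
      · refine .inr (.inr ⟨by omega, fun h => ?_⟩)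
        have := hx3 h.2 x hx (by simp)
        omega
    · rintro (rfl | h | ⟨h, h'⟩)
      · exact hkl
      · exact h.2
      · obtain ⟨y, hy, hyx⟩ := h3.2 (by omega)
        rcases Int.natAbs_eq_natAbs_iff.1 hyx with rfl | rfl
        · exact hy
        · exact absurd ⟨h, hy⟩ h'
  · rintro ⟨T, hT, h1, h2⟩
    have hT' : ∀ x, x ∈ T → 1 ≤ x ∧ x ≤ n ∧ x ≠ k.natAbs := fun x hx => (hI x).1 (hT hx)
    simp only [mem_signSet, hI] at h2
    refine ⟨h1.map_on fun x hx y hy hxy => ?_, fun j => ⟨?_, fun hj => ?_⟩⟩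
    · rw [h2] at hx hy
      have hx1 := hT' (-x)
      have hy1 := hT' (-y)
      rcases Int.natAbs_eq_natAbs_iff.1 hxy with rfl | rfl
      · rfl
      · rw [neg_neg] at *
        rcases hx with hx | hx | hx <;> rcases hy with hy | hy | hy <;> first | omega | grind
    · rintro ⟨x, hx, rfl⟩
      rw [h2] at hx
      rcases hx with rfl | hx | hx
      · omega
      · have := hT' _ hx
        omega
      · omega
    · by_cases h3 : j = k.natAbs
      · exact ⟨k, hkl, by omega⟩
      · by_cases h4 : (j : ℤ) ∈ T
        · exact ⟨-j, (h2 _).2 (.inr (.inl (by simpa using h4))), by simp⟩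
        · exact ⟨j, (h2 _).2 (.inr (.inr ⟨by omega, h4⟩)), by simp⟩

theorem card_signedAndre_eq_sum (hk : 1 ≤ k.natAbs) (hkn : k.natAbs ≤ n)
    (hI : ∀ x, x ∈ I ↔ 1 ≤ x ∧ x ≤ n ∧ x ≠ k.natAbs) :
    Nat.card {l : List ℤ // IsSignedAndre n l ∧ l.getLast? = some k} =
      ∑ T ∈ I.powerset, entringer #{x ∈ signSet k I T | x < k} #{x ∈ signSet k I T | k < x} := by
  rw [Nat.subtype_card (I.powerset.biUnion fun T => andreWords (signSet k I T) (· = some k)),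
    card_biUnion]
  · exact sum_congr rfl fun T _ => card_andreWords_last (mem_insert_self _ _)
  · intro T hT T' hT' hne
    rw [Function.onFun, disjoint_left]
    intro l hl hl'
    rw [mem_andreWords] at hl hl'
    refine hne (signSet_injOn (k := k) (fun x hx => ?_) hT hT' (ext fun x => ?_))
    · have := (hI x).1 hx
      omega
    · rw [← hl.1.2, hl'.1.2]
  · intro l
    simp only [mem_biUnion, mem_powerset, mem_andreWords]
    have hlen : IsSignedPerm n l → l.length = n := fun h => by simpa using h.length_eq
    constructor
    · rintro ⟨T, hT, h1, h2, h3⟩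
      have h4 := (isSignedPerm_iff_exists_signSet hk hkn hI (List.mem_of_getLast? h3)).2
        ⟨T, hT, h1⟩
      have h5 := (andreWord_iff_lowerSubword h1.1).1 h2
      rw [hlen h4] at h5
      exact ⟨⟨h4, h5⟩, h3⟩
    · rintro ⟨⟨h1, h2⟩, h3⟩
      obtain ⟨T, hT, h4⟩ :=
        (isSignedPerm_iff_exists_signSet hk hkn hI (List.mem_of_getLast? h3)).1 h1
      refine ⟨T, hT, h4, (andreWord_iff_lowerSubword h4.1).2 ?_, h3⟩
      rw [hlen h1]
      exact h2

theorem card_image_neg_union {X Y : Finset ℤ} (hXY : ∀ x ∈ X, ∀ y ∈ Y, 0 < x ∧ 0 < y) :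
    #(X.image (fun x => -x) ∪ Y) = #X + #Y := by
  rw [card_union_of_disjoint, card_image_of_injective _ neg_injective]
  rw [disjoint_left]
  intro x hx hy
  obtain ⟨y, hy', rfl⟩ := mem_image.1 hx
  have := hXY y hy' _ hy
  omega

theorem card_signedAndre_last_pos (a r : ℕ) :
    Nat.card {l : List ℤ // IsSignedAndre (a + r + 1) l ∧ l.getLast? = some ((a : ℤ) + 1)} =
      arnoldPos a r := by
  have ha : ((a : ℤ) + 1).natAbs = a + 1 := by omega
  have hBC : Disjoint (Icc (1 : ℤ) a) (Icc ((a : ℤ) + 2) (a + r + 1)) := by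
    rw [disjoint_left]
    intro x
    rw [mem_Icc, mem_Icc]
    omega
  rw [card_signedAndre_eq_sum (I := Icc (1 : ℤ) a ∪ Icc ((a : ℤ) + 2) (a + r + 1))
      (by omega) (by omega) (fun x => by
        rw [mem_union, mem_Icc, mem_Icc, ha]
        push_cast
        omega),
    sum_powerset_union hBC _ (fun _ j => entringer (a + j) (r - j))]
  · simp only [Int.card_Icc, ← sum_mul]
    rw [show ((a : ℤ) + 1 - 1).toNat = a by omega,
      show ((a : ℤ) + r + 1 + 1 - (a + 2)).toNat = r by omega, Nat.sum_range_choose, arnoldPos,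
      Nat.sum_antidiagonal_eq_sum_range_succ (fun i j => r.choose i * entringer (a + i) j)]
  · intro X hX Y hY
    have hX' : ∀ x ∈ X, 1 ≤ x ∧ x ≤ a := fun x hx => mem_Icc.1 (hX hx)
    have hY' : ∀ x ∈ Y, (a : ℤ) + 2 ≤ x ∧ x ≤ a + r + 1 := fun x hx => mem_Icc.1 (hY hx)
    have hd : Disjoint X Y := (hBC.mono_left hX).mono_right hY
    set I := Icc (1 : ℤ) a ∪ Icc ((a : ℤ) + 2) (a + r + 1)
    have h1 : {x ∈ signSet ((a : ℤ) + 1) I (X ∪ Y) | x < (a : ℤ) + 1} =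
        (X ∪ Y).image (fun x => -x) ∪ (Icc (1 : ℤ) a \ X) := by
      ext x
      have := hX' (-x)
      have := hY' (-x)
      have := hX' x
      have := hY' x
      simp only [mem_filter, mem_signSet, I, mem_union, mem_Icc, mem_sdiff, mem_image,
        neg_eq_iff_eq_neg, exists_eq_right]
      clear hX' hY'
      grind
    have h2 : {x ∈ signSet ((a : ℤ) + 1) I (X ∪ Y) | (a : ℤ) + 1 < x} =
        Icc ((a : ℤ) + 2) (a + r + 1) \ Y := by
      ext x
      have := hX' (-x)
      have := hY' (-x)
      have := hX' x
      have := hY' x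
      simp only [mem_filter, mem_signSet, I, mem_union, mem_Icc, mem_sdiff]
      clear hX' hY'
      grind
    have h3 := card_le_card hX
    rw [h1, h2, card_image_neg_union, card_union_of_disjoint hd, card_sdiff_of_subset hX,
      card_sdiff_of_subset hY]
    · rw [Int.card_Icc] at h3 ⊢
      rw [Int.card_Icc]
      congr 1 <;> omega
    · intro x hx y hy
      rw [mem_sdiff, mem_Icc] at hy
      rcases mem_union.1 hx with hx | hx
      · have := hX' x hx
        omega
      · have := hY' x hx
        omega

theorem card_signedAndre_last_neg (a r : ℕ) :
    Nat.card {l : List ℤ // IsSignedAndre (a + r + 1) l ∧ l.getLast? = some (-((a : ℤ) + 1))} =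
      arnoldNeg a r := by
  have ha : (-((a : ℤ) + 1)).natAbs = a + 1 := by omega
  have hBC : Disjoint (Icc (1 : ℤ) a) (Icc ((a : ℤ) + 2) (a + r + 1)) := by
    rw [disjoint_left]
    intro x
    rw [mem_Icc, mem_Icc]
    omega
  rw [card_signedAndre_eq_sum (I := Icc (1 : ℤ) a ∪ Icc ((a : ℤ) + 2) (a + r + 1))
      (by omega) (by omega) (fun x => by
        rw [mem_union, mem_Icc, mem_Icc, ha]
        push_cast
        omega),
    sum_powerset_union hBC _ (fun _ j => entringer j (a + (r - j)))]
  · simp only [Int.card_Icc, ← sum_mul]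
    rw [show ((a : ℤ) + 1 - 1).toNat = a by omega,
      show ((a : ℤ) + r + 1 + 1 - (a + 2)).toNat = r by omega, Nat.sum_range_choose, arnoldNeg,
      Nat.sum_antidiagonal_eq_sum_range_succ (fun i j => r.choose i * entringer i (a + j))]
  · intro X hX Y hY
    have hX' : ∀ x ∈ X, 1 ≤ x ∧ x ≤ a := fun x hx => mem_Icc.1 (hX hx)
    have hY' : ∀ x ∈ Y, (a : ℤ) + 2 ≤ x ∧ x ≤ a + r + 1 := fun x hx => mem_Icc.1 (hY hx)
    set I := Icc (1 : ℤ) a ∪ Icc ((a : ℤ) + 2) (a + r + 1)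
    have h1 : {x ∈ signSet (-((a : ℤ) + 1)) I (X ∪ Y) | x < -((a : ℤ) + 1)} =
        Y.image (fun x => -x) := by
      ext x
      have := hX' (-x)
      have := hY' (-x)
      have := hX' x
      have := hY' x
      simp only [mem_filter, mem_signSet, I, mem_union, mem_Icc, mem_image,
        neg_eq_iff_eq_neg, exists_eq_right]
      clear hX' hY'
      grind
    have h2 : {x ∈ signSet (-((a : ℤ) + 1)) I (X ∪ Y) | -((a : ℤ) + 1) < x} =
        X.image (fun x => -x) ∪
          ((Icc (1 : ℤ) a \ X) ∪ (Icc ((a : ℤ) + 2) (a + r + 1) \ Y)) := by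
      ext x
      have := hX' (-x)
      have := hY' (-x)
      have := hX' x
      have := hY' x
      simp only [mem_filter, mem_signSet, I, mem_union, mem_Icc, mem_sdiff, mem_image,
        neg_eq_iff_eq_neg, exists_eq_right]
      clear hX' hY'
      grind
    have h3 := card_le_card hX
    rw [h1, h2, card_image_neg_union, card_image_of_injective _ neg_injective,
      card_union_of_disjoint ((hBC.mono_left sdiff_subset).mono_right sdiff_subset),
      card_sdiff_of_subset hX, card_sdiff_of_subset hY]
    · rw [Int.card_Icc] at h3 ⊢
      rw [Int.card_Icc]
      congr 1
      omega
    · intro x hx y hy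
      have h4 := hX' x hx
      rw [mem_union, mem_sdiff, mem_sdiff, mem_Icc, mem_Icc] at hy
      omega

end Signed

end SignedAndre

/-- For `1 ≤ |k| ≤ n`, the number of signed André permutations of `[n]` with last
entry `k` equals the Arnold number `S n k`. -/
theorem card_signedAndre_last_eq_arnold
    (S : ℕ → ℤ → ℕ)
    (hS11 : S 1 1 = 1) (hS1m1 : S 1 (-1) = 1)
    (hSnn : ∀ n : ℕ, 2 ≤ n → S n (-(n : ℤ)) = 0)
    (hSpos : ∀ (n : ℕ) (k : ℤ), 1 < k → k ≤ (n : ℤ) →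
      S n k = S n (k - 1) + S (n - 1) (-k + 1))
    (hSone : ∀ n : ℕ, 1 < n → S n 1 = S n (-1))
    (hSneg : ∀ (n : ℕ) (k : ℤ), -(n : ℤ) < k → k ≤ -1 →
      S n k = S n (k - 1) + S (n - 1) (-k))
    (n : ℕ) (k : ℤ) (hn : 1 ≤ n) (hk : 1 ≤ |k|) (hkn : |k| ≤ (n : ℤ)) :
    Nat.card {l : List ℤ // IsSignedAndre n l ∧ l.getLast? = some k} = S n k := by
  obtain ⟨a, ha⟩ : ∃ a : ℕ, k.natAbs = a + 1 := ⟨k.natAbs - 1, by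
    rw [Int.abs_eq_natAbs] at hk
    omega⟩
  obtain ⟨r, rfl⟩ : ∃ r : ℕ, n = a + r + 1 := ⟨n - a - 1, by
    rw [Int.abs_eq_natAbs] at hkn
    omega⟩
  obtain ⟨hp, hm⟩ :=
    SignedAndre.eq_arnold_of_rec S hS11 hS1m1 hSnn hSpos hSone hSneg _ a r rfl
  obtain rfl | rfl : k = (a : ℤ) + 1 ∨ k = -((a : ℤ) + 1) := by omega
  · rw [SignedAndre.card_signedAndre_last_pos, hp]
  · rw [SignedAndre.card_signedAndre_last_neg, hm]
end

section
/- For all integers n ≥ 2 and 2 ≤ k ≤ n, the number of Hetyei signed André permutations of [n] whose last entry is k equals the number of signed Simsun permutations of [n-1] whose last entry is k-1; that is, #DA^H_{n,k} = #RS^B_{n-1,k-1}. -/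
/-- André permutation of `[n]`, as a list that is a permutation of `1, …, n`:
every subword `σ_[k]` (entries `1, …, k` in the order they appear) has no
double descents and ends with an ascent. -/
def IsAndre (n : ℕ) (l : List ℕ) : Prop :=
  l.Perm (List.range' 1 n) ∧
  ∀ k : ℕ, 1 ≤ k → k ≤ n →
    ¬ HasDoubleDescent (l.filter (fun x => decide (x ≤ k))) ∧
    EndsWithAscent (l.filter (fun x => decide (x ≤ k)))

/-- Whenever `|l i|` is minimal among `|l i|, …, |l (last)|`, the entry `l i` is positive. -/
def PosAtRightMin (l : List ℤ) : Prop :=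
  ∀ i : ℕ, ∀ hi : i < l.length,
    (∀ j : ℕ, i ≤ j → ∀ hj : j < l.length,
      (l.get ⟨i, hi⟩).natAbs ≤ (l.get ⟨j, hj⟩).natAbs) →
    0 < l.get ⟨i, hi⟩

namespace SignedAndre

/-- The number of descents of the word of absolute values. -/
def des : List ℤ → ℕ
  | [] => 0
  | [_] => 0
  | a :: b :: r => (if b.natAbs < a.natAbs then 1 else 0) + des (b :: r)

/-- The word of absolute values has no double descents and, if `e` is true and it has at least two
letters, it ends with an ascent. -/
def Admissible (e : Bool) : List ℤ → Prop
  | [] => True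
  | [_] => True
  | [a, b] => e = true → a.natAbs < b.natAbs
  | a :: b :: c :: r =>
    (a.natAbs ≤ b.natAbs ∨ b.natAbs ≤ c.natAbs) ∧ Admissible e (b :: c :: r)

/-- The words obtained by inserting `s` into an admissible word, not at the end, so that the
result is again admissible (when `s` exceeds all letters in absolute value). -/
def insertions (e : Bool) (s : ℤ) : List ℤ → List (List ℤ)
  | [] => []
  | [a] => if e then [] else [[s, a]]
  | a :: b :: r =>
    (if a.natAbs ≤ b.natAbs then [s :: a :: b :: r] else []) ++
      (insertions e s (b :: r)).map (a :: ·)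

/-- All signed words obtained from `p` by inserting a new largest letter `±N`. -/
def children (e : Bool) (N : ℤ) (p : List ℤ) : List (List ℤ) :=
  insertions e N p ++ (insertions e (-N) p ++ [p ++ [N]])

/-- The signed Simsun (`e = false`) or signed André (`e = true`) permutations of `[n]`. -/
def words (e : Bool) : ℕ → List (List ℤ)
  | 0 => [[]]
  | n + 1 => (words e n).flatMap (children e ((n : ℤ) + 1))

/-- The common form of the defining conditions of signed Simsun and André permutations. -/
def IsWord (e : Bool) (n : ℕ) (l : List ℤ) : Prop :=
  IsSignedPerm n l ∧
  (∀ k, 1 ≤ k → k ≤ n → Admissible e (l.filter fun x => decide (x.natAbs ≤ k))) ∧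
  PosAtRightMin l

theorem hasDoubleDescent_cons_s12 (a b c : ℕ) (r : List ℕ) :
    HasDoubleDescent (a :: b :: c :: r) ↔ (b < a ∧ c < b) ∨ HasDoubleDescent (b :: c :: r) := by
  constructor
  · rintro ⟨i, h, h1, h2⟩
    cases i with
    | zero => exact Or.inl ⟨h1, h2⟩
    | succ i => exact Or.inr ⟨i, by simpa using h, h1, h2⟩
  · rintro (⟨h1, h2⟩ | ⟨i, h, h1, h2⟩)
    · exact ⟨0, by simp, h1, h2⟩
    · exact ⟨i + 1, by simpa using h, h1, h2⟩

theorem endsWithAscent_cons_s12 (a b c : ℕ) (r : List ℕ) :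
    EndsWithAscent (a :: b :: c :: r) ↔ EndsWithAscent (b :: c :: r) := by
  simp [EndsWithAscent]

theorem admissible_iff (e : Bool) (l : List ℤ) (hl : l ≠ []) :
    Admissible e l ↔ ¬ HasDoubleDescent (l.map Int.natAbs) ∧
      (e = true → EndsWithAscent (l.map Int.natAbs)) := by
  induction l using Admissible.induct with
  | case1 => simp at hl
  | case2 a =>
    simp only [Admissible, HasDoubleDescent, EndsWithAscent]
    simp
  | case3 a b =>
    simp only [Admissible, HasDoubleDescent, EndsWithAscent]
    simp
  | case4 a b c r ih =>
    have := ih (by simp)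
    simp only [List.map_cons] at this ⊢
    rw [hasDoubleDescent_cons_s12, endsWithAscent_cons_s12, Admissible, this]
    grind

theorem posAtRightMin_cons (a : ℤ) (l : List ℤ) :
    PosAtRightMin (a :: l) ↔
      ((∀ b ∈ l, a.natAbs ≤ b.natAbs) → 0 < a) ∧ PosAtRightMin l := by
  constructor
  · intro h
    refine ⟨fun hb => h 0 (by simp) ?_, fun i hi hj => h (i + 1) (by simpa using hi) ?_⟩
    · intro j _ hj
      cases j with
      | zero => simp
      | succ j => exact hb _ (List.get_mem _ _)
    · intro j hij hj'
      obtain ⟨j, rfl⟩ : ∃ j', j = j' + 1 := ⟨j - 1, by omega⟩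
      exact hj j (by omega) (by simpa using hj')
  · rintro ⟨h1, h2⟩ i hi h
    cases i with
    | zero =>
      refine h1 fun b hb => ?_
      obtain ⟨j, hj, rfl⟩ := List.mem_iff_getElem.1 hb
      exact h (j + 1) (by omega) (by simpa using hj)
    | succ i =>
      refine h2 i (by simpa using hi) fun j hij hj => ?_
      exact h (j + 1) (by omega) (by simpa using hj)

theorem posAtRightMin_nil : PosAtRightMin [] := fun i hi => by simp at hi

theorem posAtRightMin_insert (s : ℤ) (u v : List ℤ)
    (hs : ∀ x ∈ u ++ v, x.natAbs < s.natAbs) :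
    PosAtRightMin (u ++ s :: v) ↔ PosAtRightMin (u ++ v) ∧ (v = [] → 0 < s) := by
  induction u with
  | nil =>
    cases v with
    | nil => simp [posAtRightMin_cons, posAtRightMin_nil]
    | cons b v =>
      have := hs b (by simp)
      simp only [List.nil_append]
      rw [posAtRightMin_cons s]
      simp
      omega
  | cons a u ih =>
    have := hs a (by simp)
    simp only [List.cons_append, posAtRightMin_cons, ih fun x hx => hs x (by grind)]
    have : (∀ b ∈ u ++ s :: v, a.natAbs ≤ b.natAbs) ↔ ∀ b ∈ u ++ v, a.natAbs ≤ b.natAbs := by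
      grind
    rw [this, and_assoc]

theorem exists_of_mem_insertions {e : Bool} {s : ℤ} {p c : List ℤ}
    (h : c ∈ insertions e s p) : ∃ u v, p = u ++ v ∧ v ≠ [] ∧ c = u ++ s :: v := by
  induction p using des.induct generalizing c with
  | case1 => simp [insertions] at h
  | case2 a =>
    cases e <;> simp [insertions] at h
    exact ⟨[], [a], by simp [h]⟩
  | case3 a b r ih =>
    simp only [insertions, List.mem_append, List.mem_map] at h
    obtain h | ⟨c, hc, rfl⟩ := h
    · exact ⟨[], a :: b :: r, by grind⟩
    · obtain ⟨u, v, h1, h2, rfl⟩ := ih hc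
      exact ⟨a :: u, v, by simp [h1], h2, rfl⟩

theorem admissible_tail {e : Bool} {a : ℤ} {l : List ℤ} (h : Admissible e (a :: l)) :
    Admissible e l := by
  match l, h with
  | [], _ => trivial
  | [b], _ => trivial
  | b :: c :: r, h => exact h.2

theorem mem_insertions_iff {e : Bool} {s : ℤ} {u v : List ℤ} (hv : v ≠ [])
    (hp : Admissible e (u ++ v)) (hs : ∀ x ∈ u ++ v, x.natAbs < s.natAbs) :
    u ++ s :: v ∈ insertions e s (u ++ v) ↔ Admissible e (u ++ s :: v) := by
  induction u with
  | nil =>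
    match v, hv with
    | [a], _ =>
      have := hs a (by simp)
      cases e <;> simp [insertions, Admissible]
      omega
    | a :: b :: r, _ =>
      have h1 : s.natAbs ≠ a.natAbs := (hs a (by simp)).ne'
      have h2 := hs a (by simp)
      have h3 : a ≠ s := by rintro rfl; exact h1 rfl
      simp only [List.nil_append] at hp
      simp [insertions, Admissible, hp, h3]
      omega
  | cons a u ih =>
    have ih := ih (admissible_tail hp) fun x hx => hs x (by grind)
    have h2 := hs a (by simp)
    have h3 : a ≠ s := by rintro rfl; exact h2.ne rfl
    have key : Admissible e (a :: (u ++ s :: v)) ↔ Admissible e (u ++ s :: v) := by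
      refine ⟨admissible_tail, fun h => ?_⟩
      match u, v, hv, hp, hs, h with
      | [], b :: v, _, hp, hs, h => exact ⟨Or.inl h2.le, h⟩
      | [b], c :: v, _, hp, hs, h => exact ⟨Or.inr (hs b (by simp)).le, h⟩
      | b :: c :: u, v, _, hp, hs, h => exact ⟨hp.1, h⟩
    rw [List.cons_append, List.cons_append, key, ← ih]
    obtain ⟨b, r, hbr⟩ : ∃ b r, u ++ v = b :: r := List.exists_cons_of_ne_nil (by simp [hv])
    rw [hbr]
    simp only [insertions, List.mem_append, List.mem_map]
    grind

theorem nodup_insertions {e : Bool} {s : ℤ} {p : List ℤ} (hs : s ∉ p) :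
    (insertions e s p).Nodup := by
  induction p using des.induct with
  | case1 => simp [insertions]
  | case2 a => cases e <;> simp [insertions]
  | case3 a b r ih =>
    have ih := (ih (by grind)).map (List.cons_injective (a := a))
    simp only [insertions]
    refine List.Nodup.append (by split_ifs <;> simp) ih ?_
    intro c h1 h2
    grind

theorem isWord_length {e : Bool} {n : ℕ} {p : List ℤ} (h : IsWord e n p) : p.length = n := by
  simpa using h.1.length_eq

theorem isWord_bound {e : Bool} {n : ℕ} {p : List ℤ} (h : IsWord e n p) :
    ∀ x ∈ p, x.natAbs ≤ n := by
  intro x hx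
  have := h.1.mem_iff.1 (List.mem_map_of_mem hx)
  rw [List.mem_range'_1] at this
  omega

theorem isWord_admissible {e : Bool} {n : ℕ} {p : List ℤ} (h : IsWord e n p) :
    Admissible e p := by
  cases n with
  | zero =>
    rw [List.length_eq_zero_iff.1 (isWord_length h)]
    trivial
  | succ n =>
    have := h.2.1 (n + 1) (by omega) le_rfl
    rwa [List.filter_eq_self.2] at this
    intro x hx
    simpa using isWord_bound h x hx

/-- A word of size `n + 1` is a word of size `n` with `±(n + 1)` inserted. -/
theorem isWord_insert {e : Bool} {n : ℕ} {s : ℤ} {u v : List ℤ} (hs : s.natAbs = n + 1)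
    (hb : ∀ x ∈ u ++ v, x.natAbs ≤ n) :
    IsWord e (n + 1) (u ++ s :: v) ↔
      IsWord e n (u ++ v) ∧ Admissible e (u ++ s :: v) ∧ (v = [] → 0 < s) := by
  have hperm : IsSignedPerm (n + 1) (u ++ s :: v) ↔ IsSignedPerm n (u ++ v) := by
    unfold IsSignedPerm
    have h1 : (List.map Int.natAbs (u ++ s :: v)).Perm
        ((n + 1) :: List.map Int.natAbs (u ++ v)) := by
      rw [← hs, ← List.map_cons]
      exact List.perm_middle.map _
    have h2 : (List.range' 1 (n + 1)).Perm ((n + 1) :: List.range' 1 n) := by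
      rw [List.range'_1_concat, Nat.add_comm 1 n]
      exact List.perm_append_singleton _ _
    rw [h1.congr_left, h2.congr_right, List.perm_cons]
  have hpos := posAtRightMin_insert s u v fun x hx => by have := hb x hx; omega
  have hlow : ∀ k, k ≤ n → (u ++ s :: v).filter (fun x => decide (x.natAbs ≤ k)) =
      (u ++ v).filter (fun x => decide (x.natAbs ≤ k)) := by
    intro k hk
    simp only [List.filter_append]
    rw [List.filter_cons_of_neg (by simp; omega)]
  have htop : (u ++ s :: v).filter (fun x => decide (x.natAbs ≤ n + 1)) = u ++ s :: v := by
    refine List.filter_eq_self.2 fun x hx => ?_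
    have : x = s ∨ x ∈ u ++ v := by grind
    obtain rfl | h := this
    · simp [hs]
    · have := hb x h
      simp only [decide_eq_true_eq]
      omega
  have hadm : (∀ k, 1 ≤ k → k ≤ n + 1 →
      Admissible e ((u ++ s :: v).filter fun x => decide (x.natAbs ≤ k))) ↔
      (∀ k, 1 ≤ k → k ≤ n → Admissible e ((u ++ v).filter fun x => decide (x.natAbs ≤ k))) ∧
      Admissible e (u ++ s :: v) := by
    constructor
    · intro h
      refine ⟨fun k h1 h2 => ?_, ?_⟩
      · rw [← hlow k h2]
        exact h k h1 (by omega)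
      · rw [← htop]
        exact h _ (by omega) le_rfl
    · rintro ⟨h1, h2⟩ k hk hk'
      obtain hk' | rfl := Nat.lt_or_eq_of_le hk'
      · rw [hlow k (by omega)]
        exact h1 k hk (by omega)
      · rwa [htop]
  unfold IsWord
  rw [hperm, hpos, hadm]
  tauto

theorem admissible_concat {e : Bool} {s : ℤ} {p : List ℤ} (hp : Admissible e p)
    (hs : ∀ x ∈ p, x.natAbs < s.natAbs) : Admissible e (p ++ [s]) := by
  induction p using Admissible.induct with
  | case1 => trivial
  | case2 a => exact fun _ => hs a (by simp)
  | case3 a b => exact ⟨Or.inr (hs b (by simp)).le, fun _ => hs b (by simp)⟩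
  | case4 a b c r ih => exact ⟨hp.1, ih hp.2 fun x hx => hs x (by grind)⟩

theorem des_concat {s : ℤ} {p : List ℤ} (hs : ∀ x ∈ p, x.natAbs < s.natAbs) :
    des (p ++ [s]) = des p := by
  induction p using des.induct with
  | case1 => rfl
  | case2 a =>
    have := hs a (by simp)
    simp [des]
    omega
  | case3 a b r ih =>
    have := ih fun x hx => hs x (by grind)
    simp only [List.cons_append] at this
    simp only [List.cons_append, des, this]

theorem exists_eq_insert {e : Bool} {n : ℕ} {c : List ℤ} (hc : IsWord e (n + 1) c) :
    ∃ s u v, c = u ++ s :: v ∧ s.natAbs = n + 1 ∧ ∀ x ∈ u ++ v, x.natAbs ≤ n := by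
  have hm : n + 1 ∈ c.map Int.natAbs := hc.1.mem_iff.2 (by rw [List.mem_range'_1]; omega)
  obtain ⟨s, hsc, hs⟩ := List.mem_map.1 hm
  obtain ⟨u, v, rfl⟩ := List.append_of_mem hsc
  refine ⟨s, u, v, rfl, hs, fun x hx => ?_⟩
  have hnd : ((u ++ s :: v).map Int.natAbs).Nodup := hc.1.nodup_iff.2 List.nodup_range'
  have h1 := (List.perm_middle.map Int.natAbs).nodup_iff.1 hnd
  rw [List.map_cons, List.nodup_cons] at h1
  have h2 : x.natAbs ≠ n + 1 := fun h => h1.1 (by rw [hs, ← h]; exact List.mem_map_of_mem hx)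
  have := isWord_bound hc x (by grind)
  omega

theorem mem_children_iff {e : Bool} {n : ℕ} {p c : List ℤ} (hp : IsWord e n p) :
    c ∈ children e ((n : ℤ) + 1) p ↔ IsWord e (n + 1) c ∧
      c.filter (fun x => decide (x.natAbs ≤ n)) = p := by
  have hb := isWord_bound hp
  have hfil : ∀ s : ℤ, ∀ u v, s.natAbs = n + 1 → (∀ x ∈ u ++ v, x.natAbs ≤ n) →
      (u ++ s :: v).filter (fun x => decide (x.natAbs ≤ n)) = u ++ v := by
    intro s u v hs h
    rw [List.filter_append, List.filter_cons_of_neg (by simp; omega), ← List.filter_append,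
      List.filter_eq_self]
    simpa using h
  have hins : ∀ s : ℤ, s.natAbs = n + 1 → c ∈ insertions e s p → IsWord e (n + 1) c ∧
      c.filter (fun x => decide (x.natAbs ≤ n)) = p := by
    intro s hs hc
    obtain ⟨u, v, rfl, hv, rfl⟩ := exists_of_mem_insertions hc
    refine ⟨(isWord_insert hs hb).2 ⟨hp, ?_, fun h => absurd h hv⟩, hfil s u v hs hb⟩
    exact (mem_insertions_iff hv (isWord_admissible hp) fun x hx => by
      have := hb x hx; omega).1 hc
  constructor
  · intro h
    simp only [children, List.mem_append, List.mem_singleton] at h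
    obtain h | h | rfl := h
    · exact hins _ (by omega) h
    · exact hins _ (by omega) h
    · have hN : ((n : ℤ) + 1).natAbs = n + 1 := by omega
      refine ⟨(isWord_insert hN (by simpa using hb)).2
        ⟨by simpa using hp, ?_, fun _ => by omega⟩, ?_⟩
      · exact admissible_concat (isWord_admissible hp) fun x hx => by
          have := hb x hx; omega
      · simpa using hfil _ p [] hN (by simpa using hb)
  · rintro ⟨hc, hf⟩
    obtain ⟨s, u, v, rfl, hs, huv⟩ := exists_eq_insert hc
    rw [hfil s u v hs huv] at hf
    subst hf
    obtain ⟨-, ha, hpos⟩ := (isWord_insert hs huv).1 hc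
    simp only [children, List.mem_append, List.mem_singleton]
    by_cases hv : v = []
    · have := hpos hv
      have : s = (n : ℤ) + 1 := by omega
      subst this hv
      simp
    · have hi := (mem_insertions_iff hv (isWord_admissible hp) fun x hx => by
        have := huv x hx; omega).2 ha
      obtain h | h : s = (n : ℤ) + 1 ∨ s = -((n : ℤ) + 1) := by omega
      · subst h; exact Or.inl hi
      · subst h; exact Or.inr (Or.inl hi)

theorem isWord_filter {e : Bool} {n : ℕ} {c : List ℤ} (hc : IsWord e (n + 1) c) :
    IsWord e n (c.filter fun x => decide (x.natAbs ≤ n)) := by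
  obtain ⟨s, u, v, rfl, hs, huv⟩ := exists_eq_insert hc
  rw [List.filter_append, List.filter_cons_of_neg (by simp; omega), ← List.filter_append,
    List.filter_eq_self.2 (by simpa using huv)]
  exact ((isWord_insert hs huv).1 hc).1

theorem mem_words_iff {e : Bool} {n : ℕ} {l : List ℤ} : l ∈ words e n ↔ IsWord e n l := by
  induction n generalizing l with
  | zero =>
    simp only [words, List.mem_singleton]
    constructor
    · rintro rfl
      exact ⟨by simp [IsSignedPerm], fun k h1 h2 => by omega, posAtRightMin_nil⟩
    · exact fun h => List.length_eq_zero_iff.1 (isWord_length h)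
  | succ n ih =>
    simp only [words, List.mem_flatMap]
    constructor
    · rintro ⟨p, hp, hl⟩
      exact ((mem_children_iff (ih.1 hp)).1 hl).1
    · intro h
      exact ⟨_, ih.2 (isWord_filter h), (mem_children_iff (isWord_filter h)).2 ⟨h, rfl⟩⟩

theorem getLastD_of_mem_insertions {e : Bool} {s : ℤ} {p c : List ℤ}
    (h : c ∈ insertions e s p) : c.getLastD 0 = p.getLastD 0 := by
  obtain ⟨u, v, rfl, hv, rfl⟩ := exists_of_mem_insertions h
  obtain ⟨w, x, rfl⟩ := List.eq_nil_or_concat v |>.resolve_left hv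
  simp [List.getLastD_eq_getLast?, List.getLast?_append, List.getLast?_cons]

theorem nodup_children {e : Bool} {n : ℕ} {p : List ℤ} (hp : ∀ x ∈ p, x.natAbs ≤ n) :
    (children e ((n : ℤ) + 1) p).Nodup := by
  have h1 : (n : ℤ) + 1 ∉ p := fun h => by have := hp _ h; omega
  have h2 : -((n : ℤ) + 1) ∉ p := fun h => by have := hp _ h; omega
  refine List.Nodup.append (nodup_insertions h1)
    (List.Nodup.append (nodup_insertions h2) (by simp) ?_) ?_
  · intro c hc hc'
    obtain ⟨u, v, h, hv, rfl⟩ := exists_of_mem_insertions hc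
    have : -((n : ℤ) + 1) ∈ p ++ [(n : ℤ) + 1] := by
      rw [← List.mem_singleton.1 hc']
      simp
    grind
  · intro c hc hc'
    obtain hc' | hc' := List.mem_append.1 hc'
    · obtain ⟨u, v, h, hv, rfl⟩ := exists_of_mem_insertions hc
      obtain ⟨u', v', rfl, hv', h'⟩ := exists_of_mem_insertions hc'
      have : (n : ℤ) + 1 ∈ u' ++ -((n : ℤ) + 1) :: v' := by
        rw [← h']
        simp
      grind
    · have h3 := getLastD_of_mem_insertions hc
      rw [List.mem_singleton.1 hc'] at h3
      have h4 : p ≠ [] := by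
        rintro rfl
        simp [insertions] at hc
      obtain ⟨w, x, rfl⟩ := List.eq_nil_or_concat p |>.resolve_left h4
      simp [List.getLastD_eq_getLast?] at h3
      exact h1 (by simp [h3])

theorem nodup_words (e : Bool) (n : ℕ) : (words e n).Nodup := by
  induction n with
  | zero => simp [words]
  | succ n ih =>
    rw [words, List.nodup_flatMap]
    refine ⟨fun p hp => nodup_children (isWord_bound (mem_words_iff.1 hp)), ?_⟩
    refine List.Pairwise.imp_of_mem ?_ ih
    intro p q hp hq hpq c hcp hcq
    exact hpq (((mem_children_iff (mem_words_iff.1 hp)).1 hcp).2.symm.trans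
      ((mem_children_iff (mem_words_iff.1 hq)).1 hcq).2)

/-- Among the insertions of a large letter, `des p` keep the number of descents and the others
increase it by one. -/
theorem sum_insertions {e : Bool} {s : ℤ} {p : List ℤ} (h0 : p ≠ []) (hp : Admissible e p)
    (hs : ∀ x ∈ p, x.natAbs < s.natAbs) :
    ∃ q, q + e.toNat + 2 * des p = p.length ∧ ∀ f : ℕ → ℕ,
      ((insertions e s p).map fun c => f (des c)).sum =
        des p * f (des p) + q * f (des p + 1) := by
  have hcons : ∀ (a b : ℤ) (r : List ℤ), a.natAbs ≤ b.natAbs → a.natAbs < s.natAbs →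
      ∀ f : ℕ → ℕ, ((insertions e s (b :: r)).map fun c => f (des (a :: c))) =
        ((insertions e s (b :: r)).map fun c => f (des c)) := by
    intro a b r hab has f
    refine List.map_congr_left fun c hc => ?_
    obtain ⟨u, v, h, hv, rfl⟩ := exists_of_mem_insertions hc
    cases u with
    | nil => simp [des, has.le.not_gt]
    | cons x u =>
      obtain ⟨rfl, -⟩ := List.cons.inj h
      simp [des, hab.not_gt]
  induction hn : p.length using Nat.strong_induction_on generalizing p with
  | _ m ih =>
  match p, h0 with
  | [a], _ =>
    have h1 := hs a (by simp)
    subst hn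
    cases e
    · exact ⟨1, by simp [des], fun f => by simp [insertions, des, h1]⟩
    · exact ⟨0, by simp [des], fun f => by simp [insertions, des]⟩
  | a :: b :: r, _ =>
    have ha := hs a (by simp)
    have hb := hs b (by simp)
    by_cases hab : a.natAbs ≤ b.natAbs
    · obtain ⟨q, hq, hf⟩ := ih (r.length + 1) (by simp at hn; omega) (p := b :: r) (by simp)
        (admissible_tail hp) (fun x hx => hs x (by grind)) rfl
      have hd : des (a :: b :: r) = des (b :: r) := by simp [des, hab.not_gt]
      refine ⟨q + 1, by simp at hn hq; omega, fun f => ?_⟩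
      have hd' : des (s :: a :: b :: r) = des (b :: r) + 1 := by
        rw [des, hd, if_pos ha, add_comm]
      simp only [insertions, if_pos hab, List.map_append, List.map_cons, List.map_nil,
        List.sum_append, List.sum_cons, List.sum_nil, List.map_map, Function.comp_def]
      rw [hcons a b r hab ha f, hf f, hd, hd']
      ring
    · match r with
      | [] =>
        have hlt : b.natAbs < a.natAbs := by omega
        cases e with
        | true => exact absurd (hp rfl) (by omega)
        | false =>
          refine ⟨0, by simp [des, hlt] at hn ⊢; omega, fun f => ?_⟩
          simp [insertions, des, hlt, hb, hab, ha.le.not_gt]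
      | c :: r =>
        have hlt : b.natAbs < a.natAbs := by omega
        have hbc : b.natAbs ≤ c.natAbs := hp.1.resolve_left hab
        obtain ⟨q, hq, hf⟩ := ih (r.length + 1) (by simp at hn; omega) (p := c :: r) (by simp)
          (admissible_tail (admissible_tail hp)) (fun x hx => hs x (by grind)) rfl
        have hd : des (b :: c :: r) = des (c :: r) := by simp [des, hbc.not_gt]
        have hd' : des (a :: b :: c :: r) = des (c :: r) + 1 := by
          rw [des, hd, if_pos hlt, add_comm]
        have hds : des (a :: s :: b :: c :: r) = des (c :: r) + 1 := by
          rw [des, des, hd, if_pos hb, if_neg ha.le.not_gt]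
          omega
        have hdb : ∀ x : List ℤ, des (a :: b :: x) = des (b :: x) + 1 := by
          intro x
          rw [des, if_pos hlt, add_comm]
        refine ⟨q, by simp at hn hq; omega, fun f => ?_⟩
        simp only [insertions, if_neg hab, if_pos hbc, List.map_append, List.map_cons,
          List.map_nil, List.sum_append, List.sum_cons, List.sum_nil, List.map_map,
          Function.comp_def, List.nil_append]
        simp only [hdb, hds]
        rw [hcons b c r hbc hb fun d => f (d + 1), hf fun d => f (d + 1), hd]
        ring

theorem sum_children {e : Bool} {n : ℕ} {p : List ℤ} (hp : IsWord e n p) (hn : n ≠ 0)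
    (f : ℕ → ℤ → ℕ) :
    ((children e ((n : ℤ) + 1) p).map fun c => f (des c) (c.getLastD 0)).sum =
      2 * (des p * f (des p) (p.getLastD 0) +
        (n - e.toNat - 2 * des p) * f (des p + 1) (p.getLastD 0)) +
      f (des p) ((n : ℤ) + 1) := by
  have hb := isWord_bound hp
  have h0 : p ≠ [] := by
    rintro rfl
    exact hn (isWord_length hp).symm
  have hins : ∀ s : ℤ, s.natAbs = n + 1 →
      ((insertions e s p).map fun c => f (des c) (c.getLastD 0)).sum =
        des p * f (des p) (p.getLastD 0) +
          (n - e.toNat - 2 * des p) * f (des p + 1) (p.getLastD 0) := by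
    intro s hs
    obtain ⟨q, hq, hf⟩ := sum_insertions h0 (isWord_admissible hp)
      (s := s) fun x hx => by have := hb x hx; omega
    rw [isWord_length hp] at hq
    rw [show n - e.toNat - 2 * des p = q by omega, ← hf fun d => f d (p.getLastD 0)]
    congr 1
    refine List.map_congr_left fun c hc => ?_
    rw [getLastD_of_mem_insertions hc]
  have hd : des (p ++ [(n : ℤ) + 1]) = des p :=
    des_concat fun x hx => by have := hb x hx; omega
  simp only [children, List.map_append, List.sum_append, List.map_cons, List.map_nil,
    List.sum_cons, List.sum_nil]
  rw [hins _ (by omega), hins _ (by omega), hd]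
  simp [List.getLastD_eq_getLast?]
  ring

theorem sum_words_succ {e : Bool} {n : ℕ} (hn : n ≠ 0) (f : ℕ → ℤ → ℕ) :
    ((words e (n + 1)).map fun c => f (des c) (c.getLastD 0)).sum =
      ((words e n).map fun p => 2 * (des p * f (des p) (p.getLastD 0) +
        (n - e.toNat - 2 * des p) * f (des p + 1) (p.getLastD 0)) +
      f (des p) ((n : ℤ) + 1)).sum := by
  rw [words, List.map_flatMap, List.flatMap, List.sum_flatten, List.map_map]
  congr 1
  refine List.map_congr_left fun p hp => ?_
  exact sum_children (mem_words_iff.1 hp) hn f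

/-- The pair (number of descents, last letter) is equidistributed, up to a shift of the last letter,
on signed André permutations of `[n + 2]` and signed Simsun permutations of `[n + 1]`. -/
theorem sum_words_true_eq_false (n : ℕ) (f : ℕ → ℤ → ℕ) :
    ((words true (n + 2)).map fun c => f (des c) (c.getLastD 0)).sum =
      ((words false (n + 1)).map fun c => f (des c) (c.getLastD 0 + 1)).sum := by
  induction n generalizing f with
  | zero => simp [words, children, insertions, des]
  | succ n ih =>
    rw [sum_words_succ (by omega), sum_words_succ (by omega) fun d k => f d (k + 1),
      ih fun d k => 2 * (d * f d k + (n + 2 - true.toNat - 2 * d) * f (d + 1) k) +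
        f d (((n + 1 + 1 : ℕ) : ℤ) + 1)]
    simp

theorem card_isWord_last (e : Bool) (n : ℕ) (k : ℤ) (hk : k ≠ 0) :
    Nat.card {l : List ℤ // IsWord e n l ∧ l.getLast? = some k} =
      ((words e n).map fun c => if c.getLastD 0 = k then 1 else 0).sum := by
  rw [Nat.subtype_card ((words e n).filter fun c => decide (c.getLastD 0 = k)).toFinset]
  · rw [List.toFinset_card_of_nodup ((nodup_words e n).filter _)]
    generalize words e n = L
    induction L with
    | nil => rfl
    | cons a L ih =>
      rw [List.map_cons, List.sum_cons, ← ih, List.filter_cons]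
      split_ifs <;> simp_all [add_comm]
  · intro l
    rw [List.mem_toFinset, List.mem_filter, mem_words_iff, decide_eq_true_eq,
      List.getLastD_eq_getLast?]
    cases l.getLast? with
    | none => simp [hk.symm]
    | some x => simp

theorem isWord_iff (e : Bool) (n : ℕ) (l : List ℤ) :
    IsWord e n l ↔ IsSignedPerm n l ∧ ((l.map Int.natAbs).Perm (List.range' 1 n) ∧
      ∀ k, 1 ≤ k → k ≤ n →
        ¬ HasDoubleDescent ((l.map Int.natAbs).filter fun x => decide (x ≤ k)) ∧
        (e = true → EndsWithAscent ((l.map Int.natAbs).filter fun x => decide (x ≤ k)))) ∧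
      PosAtRightMin l := by
  unfold IsWord
  refine and_congr_right fun h => and_congr_left fun _ => ?_
  rw [and_iff_right (show (l.map Int.natAbs).Perm (List.range' 1 n) from h)]
  refine forall_congr' fun k => forall_congr' fun h1 => forall_congr' fun h2 => ?_
  rw [admissible_iff, List.filter_map, Function.comp_def]
  obtain ⟨x, hx, hx1⟩ := List.mem_map.1 (h.mem_iff.2 (List.mem_range'_1.2 ⟨le_rfl, by omega⟩))
  exact List.ne_nil_of_mem (a := x) (by simp [hx, hx1, h1])

end SignedAndre

/-- For `n ≥ 2` and `2 ≤ k ≤ n`, the number of Hetyei signed André permutations of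
`[n]` with last entry `k` equals the number of signed Simsun permutations of
`[n-1]` with last entry `k-1`. -/
theorem card_hetyei_signedAndre_last_eq_card_signedSimsun_last
    (n k : ℕ) (hn : 2 ≤ n) (hk : 2 ≤ k) (hkn : k ≤ n) :
    Nat.card {l : List ℤ // IsSignedPerm n l ∧ IsAndre n (l.map Int.natAbs) ∧
        PosAtRightMin l ∧ l.getLast? = some (k : ℤ)}
      = Nat.card {l : List ℤ // IsSignedPerm (n - 1) l ∧ IsSimsun (n - 1) (l.map Int.natAbs) ∧
        PosAtRightMin l ∧ l.getLast? = some ((k : ℤ) - 1)} := by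
  obtain ⟨m, rfl⟩ : ∃ m, n = m + 2 := ⟨n - 2, by omega⟩
  have hA : ∀ l : List ℤ, (IsSignedPerm (m + 2) l ∧ IsAndre (m + 2) (l.map Int.natAbs) ∧
      PosAtRightMin l ∧ l.getLast? = some (k : ℤ)) ↔
      (SignedAndre.IsWord true (m + 2) l ∧ l.getLast? = some (k : ℤ)) := by
    intro l
    simp only [SignedAndre.isWord_iff, IsAndre, forall_const, and_assoc]
  have hS : ∀ l : List ℤ, (IsSignedPerm (m + 1) l ∧ IsSimsun (m + 1) (l.map Int.natAbs) ∧
      PosAtRightMin l ∧ l.getLast? = some ((k : ℤ) - 1)) ↔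
      (SignedAndre.IsWord false (m + 1) l ∧ l.getLast? = some ((k : ℤ) - 1)) := by
    intro l
    simp only [SignedAndre.isWord_iff, IsSimsun, Bool.false_eq_true, false_imp_iff, and_true,
      and_assoc]
  rw [show m + 2 - 1 = m + 1 from rfl, Nat.card_congr (Equiv.subtypeEquivRight hA),
    Nat.card_congr (Equiv.subtypeEquivRight hS),
    SignedAndre.card_isWord_last _ _ _ (by omega), SignedAndre.card_isWord_last _ _ _ (by omega),
    SignedAndre.sum_words_true_eq_false m fun _ x => if x = (k : ℤ) then 1 else 0]
  simp only [eq_sub_iff_add_eq]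
end
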